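/- arXiv:2107.04516 — 3 statements merged into one kernel-verified Lean document; each statement's English description precedes it below -/
import Mathlib

section
/- Let 𝒯 be a staged tree whose homogenised algebra im φ_𝒯 is isomorphic, as an ℝ-algebra, to a monomial algebra, i.e. to a subalgebra of a polynomial ring generated by finitely many monomials. Then ker φ_𝒯 is toric after an appropriate linear change of coordinates: there exist linearly independent linear forms ℓ₁,…,ℓ_n in ℝ[p₁,…,p_n] in which ker φ_𝒯 is generated by binomials. -/
noncomputable section
open scoped Classical
open MvPolynomial

/-- A staged tree: a finite rooted tree with edges directed away from the root,
each non-root vertex `c` carrying the label `label c` of the edge from `parent c` to `c`;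
labels of outgoing edges of a vertex are pairwise distinct, and the outgoing label sets
of two vertices are either equal (same stage) or disjoint. -/
structure StagedTree (Θ : Type) [DecidableEq Θ] : Type 1 where
  V : Type
  fintypeV : Fintype V
  decEqV : DecidableEq V
  root : V
  parent : V → V
  label : V → Θ
  parent_root : parent root = root
  reaches_root : ∀ v : V, ∃ n : ℕ, parent^[n] v = root
  label_inj : ∀ u v : V, u ≠ root → v ≠ root → parent u = parent v → label u = label v → u = v
  stage_disjoint : ∀ u v : V,
    (∀ θ : Θ, (∃ c, c ≠ root ∧ parent c = u ∧ label c = θ) ↔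
        (∃ c, c ≠ root ∧ parent c = v ∧ label c = θ)) ∨
    (∀ θ : Θ, ¬((∃ c, c ≠ root ∧ parent c = u ∧ label c = θ) ∧
        (∃ c, c ≠ root ∧ parent c = v ∧ label c = θ)))

namespace StagedTree

attribute [instance] StagedTree.fintypeV StagedTree.decEqV

variable {Θ : Type} [DecidableEq Θ] (T : StagedTree Θ)

/-- `c` is a child of `v`. -/
def IsChild (v c : T.V) : Prop := c ≠ T.root ∧ T.parent c = v

/-- `v` is a leaf (no children). -/
def IsLeaf (v : T.V) : Prop := ∀ c, ¬ T.IsChild v c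

/-- `w` lies in the subtree rooted at `v` (i.e. `v` is an ancestor of `w` or `w` itself). -/
def Desc (v w : T.V) : Prop := ∃ n : ℕ, T.parent^[n] w = v

/-- Distance of `v` from the root. -/
def depthOf (v : T.V) : ℕ := Nat.find (T.reaches_root v)

/-- The depth `d` of the tree: maximal number of edges on a root-to-leaf path. -/
def depth : ℕ := Finset.univ.sup T.depthOf

/-- The type of leaves of `T`. -/
def Leaf : Type := {v : T.V // T.IsLeaf v}

instance : Fintype T.Leaf := Subtype.fintype _

/-- Product of the labels along the root-to-`v` path, in `ℝ[Θ]`. -/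
def pathProd (v : T.V) : MvPolynomial Θ ℝ :=
  ∏ i ∈ Finset.range (T.depthOf v), X (T.label (T.parent^[i] v))

/-- Homogenised root-to-`v` path monomial `z^(d - d(λ)) ∏ θ(e)` in `ℝ[Θ, z]`,
where the variable `none` plays the role of `z`. -/
def hpm (v : T.V) : MvPolynomial (Option Θ) ℝ :=
  (X none) ^ (T.depth - T.depthOf v) *
    ∏ i ∈ Finset.range (T.depthOf v), X (some (T.label (T.parent^[i] v)))

/-- The ideal `⟨θ - z⟩` of homogenised local sum-to-one conditions. -/
def sumIdeal : Ideal (MvPolynomial (Option Θ) ℝ) :=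
  Ideal.span {f | ∃ v : T.V, ¬ T.IsLeaf v ∧
    f = (∑ c ∈ Finset.univ.filter (fun c => T.IsChild v c), X (some (T.label c))) - X none}

/-- The homogenised parametrisation `φ_T : ℝ[p] → ℝ[Θ, z]/⟨θ - z⟩`. -/
def phi : MvPolynomial T.Leaf ℝ →ₐ[ℝ] MvPolynomial (Option Θ) ℝ ⧸ T.sumIdeal :=
  aeval (fun l : T.Leaf => Ideal.Quotient.mk T.sumIdeal (T.hpm l.1))

/-- The ideal `⟨θ - 1⟩` of local sum-to-one conditions. -/
def oneIdeal : Ideal (MvPolynomial Θ ℝ) :=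
  Ideal.span {f | ∃ v : T.V, ¬ T.IsLeaf v ∧
    f = (∑ c ∈ Finset.univ.filter (fun c => T.IsChild v c), X (T.label c)) - 1}

/-- The (non-homogenised) parametrisation `φ_T : ℝ[p] → ℝ[Θ]/⟨θ - 1⟩`. -/
def phi1 : MvPolynomial T.Leaf ℝ →ₐ[ℝ] MvPolynomial Θ ℝ ⧸ T.oneIdeal :=
  aeval (fun l : T.Leaf => Ideal.Quotient.mk T.oneIdeal (T.pathProd l.1))

/-- The subtree polynomial `t(v)`: sum over all `v`-to-leaf paths of the products of
edge labels along the path. -/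
def tpoly (v : T.V) : MvPolynomial Θ ℝ :=
  ∑ l ∈ Finset.univ.filter (fun w => T.IsLeaf w ∧ T.Desc v w),
    ∏ i ∈ Finset.range (T.depthOf l - T.depthOf v), X (T.label (T.parent^[i] l))

/-- Two non-leaf vertices are in the same stage when their outgoing label sets coincide. -/
def SameStage (u v : T.V) : Prop :=
  ¬ T.IsLeaf u ∧ ¬ T.IsLeaf v ∧
    ∀ θ : Θ, (∃ c, T.IsChild u c ∧ T.label c = θ) ↔ (∃ c, T.IsChild v c ∧ T.label c = θ)

/-- `T` is balanced: `t(u_i)·t(v_j) = t(u_j)·t(v_i)` for all `u ∼ v` and all pairs of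
children matched via the common labels. -/
def Balanced : Prop :=
  ∀ u v ui uj vi vj : T.V, T.SameStage u v →
    T.IsChild u ui → T.IsChild u uj → T.IsChild v vi → T.IsChild v vj →
    T.label ui = T.label vi → T.label uj = T.label vj →
    T.tpoly ui * T.tpoly vj = T.tpoly uj * T.tpoly vi

/-- `p_{[v]}`: sum of the variables `p_r` over root-to-leaf paths through `v`. -/
def pSum (v : T.V) : MvPolynomial T.Leaf ℝ :=
  ∑ l ∈ Finset.univ.filter (fun l : T.Leaf => T.Desc v l.1), X l

/-- `T` has toric structure: there are linearly independent linear forms in which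
`ker φ_T` is generated by binomials. -/
def Toric : Prop :=
  ∃ L : T.Leaf → MvPolynomial T.Leaf ℝ,
    (∀ i, (L i).IsHomogeneous 1) ∧ LinearIndependent ℝ L ∧
    ∃ B : Set (MvPolynomial T.Leaf ℝ),
      (∀ f ∈ B, ∃ a b : T.Leaf → ℕ, f = (∏ i, L i ^ a i) - (∏ i, L i ^ b i)) ∧
      RingHom.ker T.phi.toRingHom = Ideal.span B

end StagedTree

namespace MonomialMap

variable {ι τ K : Type*} [Field K]

/-- The total exponent `∑ aᵢ hᵢ` of a monomial in generators with exponents `h`. -/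
def totalExp (h : ι → τ →₀ ℕ) : (ι →₀ ℕ) →ₗ[ℕ] (τ →₀ ℕ) := Finsupp.linearCombination ℕ h

/-- The monomial map sending the `i`-th variable to the monomial with exponent `h i`. -/
def monMap (K : Type*) [Field K] (h : ι → τ →₀ ℕ) : MvPolynomial ι K →ₐ[K] MvPolynomial τ K :=
  aeval fun i => monomial (h i) 1

/-- The family `h` minimally generates: no `h i` is a combination of the others (or zero). -/
def IsMinimalGen (h : ι → τ →₀ ℕ) : Prop :=
  ∀ i a, totalExp h a = h i → a = Finsupp.single i 1

/-- The `i`-th generator is free: its multiplicity is an invariant of the total exponent. -/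
def IsFreeGen (h : ι → τ →₀ ℕ) (i : ι) : Prop :=
  ∀ a b, totalExp h a = totalExp h b → a i = b i

/-- The ideal of binomials in the kernel of the monomial map. -/
def binomialIdeal (K : Type*) [Field K] (h : ι → τ →₀ ℕ) : Ideal (MvPolynomial ι K) :=
  Ideal.span {g | ∃ a b, totalExp h a = totalExp h b ∧ g = monomial a 1 - monomial b 1}

variable {h : ι → τ →₀ ℕ}

@[simp]
lemma totalExp_single (i : ι) : totalExp h (Finsupp.single i 1) = h i := by
  simp [totalExp]

@[simp]
lemma monMap_X (i : ι) : monMap K h (X i) = monomial (h i) 1 := by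
  simp [monMap]

@[simp]
lemma monMap_monomial (a : ι →₀ ℕ) (c : K) :
    monMap K h (monomial a c) = monomial (totalExp h a) c := by
  rw [monMap, aeval_monomial, totalExp, Finsupp.linearCombination_apply, Finsupp.prod, Finsupp.sum]
  simp only [monomial_pow, one_pow]
  rw [← monomial_sum_one, algebraMap_eq, C_mul_monomial, mul_one]

lemma coeff_monMap_eq_zero {f : MvPolynomial ι K} {w : τ →₀ ℕ}
    (hw : w ∉ Set.range (totalExp h)) : coeff w (monMap K h f) = 0 := by
  induction f using MvPolynomial.induction_on' with
  | monomial a c =>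
    rw [monMap_monomial, coeff_monomial, if_neg]
    exact fun e => hw ⟨a, e⟩
  | add p q hp hq => rw [map_add, coeff_add, hp, hq, add_zero]

/-- A chosen representative of a total exponent. -/
def rep (h : ι → τ →₀ ℕ) (w : τ →₀ ℕ) : ι →₀ ℕ := Function.invFun (totalExp h) w

lemma totalExp_rep {w : τ →₀ ℕ} (hw : w ∈ Set.range (totalExp h)) : totalExp h (rep h w) = w :=
  Function.invFun_eq hw

/-- The linear section of the monomial map given by representatives. -/
def repMap (K : Type*) [Field K] (h : ι → τ →₀ ℕ) : MvPolynomial τ K →ₗ[K] MvPolynomial ι K :=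
  (basisMonomials τ K).constr K fun w => monomial (rep h w) 1

lemma repMap_monomial (w : τ →₀ ℕ) (c : K) :
    repMap K h (monomial w c) = monomial (rep h w) c := by
  have : monomial w c = c • basisMonomials τ K w := by simp [smul_monomial]
  rw [this, map_smul, repMap, Module.Basis.constr_basis, smul_monomial, smul_eq_mul, mul_one]

lemma sub_repMap_mem (f : MvPolynomial ι K) :
    f - repMap K h (monMap K h f) ∈ binomialIdeal K h := by
  induction f using MvPolynomial.induction_on' with
  | monomial a c =>
    have e : monomial a c - monomial (rep h (totalExp h a)) c =
        C c * (monomial a 1 - monomial (rep h (totalExp h a)) 1) := by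
      simp [mul_sub, C_mul_monomial]
    rw [monMap_monomial, repMap_monomial, e]
    exact Ideal.mul_mem_left _ _ (Ideal.subset_span ⟨_, _, (totalExp_rep ⟨a, rfl⟩).symm, rfl⟩)
  | add p q hp hq =>
    rw [map_add, map_add, add_sub_add_comm]
    exact add_mem hp hq

lemma ker_monMap : RingHom.ker (monMap K h) = binomialIdeal K h := by
  apply le_antisymm
  · intro f hf
    have := sub_repMap_mem (h := h) f
    rwa [(RingHom.mem_ker).1 hf, map_zero, sub_zero] at this
  · rw [binomialIdeal, Ideal.span_le]
    rintro _ ⟨a, b, hab, rfl⟩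
    simp [hab]

lemma IsMinimalGen.ne_zero (hh : IsMinimalGen h) (i : ι) : h i ≠ 0 := by
  intro h0
  have := hh i 0 (by simp [h0])
  simpa using congrArg (· i) this

/-- The part of an exponent supported on non-free generators. -/
def nonfree (h : ι → τ →₀ ℕ) (a : ι →₀ ℕ) : ι →₀ ℕ := a.filter fun i => ¬ IsFreeGen h i

lemma nonfree_apply_of_not (a : ι →₀ ℕ) {i : ι} (hi : ¬ IsFreeGen h i) :
    nonfree h a i = a i := by simp [nonfree, hi]

lemma nonfree_apply_of (a : ι →₀ ℕ) {i : ι} (hi : IsFreeGen h i) :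
    nonfree h a i = 0 := by simp [nonfree, hi]

lemma nonfree_add (a b : ι →₀ ℕ) : nonfree h (a + b) = nonfree h a + nonfree h b :=
  Finsupp.filter_add

lemma nonfree_single {i : ι} (hi : ¬ IsFreeGen h i) (n : ℕ) :
    nonfree h (Finsupp.single i n) = Finsupp.single i n :=
  Finsupp.filter_single_of_pos _ hi

lemma exists_common_add_nonfree {a b : ι →₀ ℕ} (hab : totalExp h a = totalExp h b) :
    ∃ c, a = c + nonfree h a ∧ b = c + nonfree h b ∧
      totalExp h (nonfree h a) = totalExp h (nonfree h b) := by
  have ha : a = a.filter (IsFreeGen h) + nonfree h a := (Finsupp.filter_add_filter_not _ _).symm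
  have hb : b = a.filter (IsFreeGen h) + nonfree h b := by
    have : a.filter (IsFreeGen h) = b.filter (IsFreeGen h) := by
      ext i
      by_cases hi : IsFreeGen h i
      · simp [hi, hi a b hab]
      · simp [hi]
    rw [this]
    exact (Finsupp.filter_add_filter_not _ _).symm
  refine ⟨_, ha, hb, ?_⟩
  rw [ha, hb, map_add, map_add] at hab
  exact add_left_cancel hab

end MonomialMap

namespace MonomialMap

variable {ι τ K : Type*} [Field K] {h : ι → τ →₀ ℕ}

/-- A derivation along the monomial map which factors through its image sends a non-free generator
into the span of monomials involving some non-free generator. -/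
lemma nonfree_rep_ne_zero [CharZero K] (hh : IsMinimalGen h)
    (E : MvPolynomial ι K →ₗ[K] MvPolynomial τ K)
    (hmul : ∀ f g, E (f * g) = monMap K h f * E g + monMap K h g * E f)
    (hker : ∀ f, monMap K h f = 0 → E f = 0)
    (hrange : ∀ f w, coeff w (E f) ≠ 0 → w ∈ Set.range (totalExp h))
    {j : ι} (hj : ¬ IsFreeGen h j) {w : τ →₀ ℕ} (hw : coeff w (E (X j)) ≠ 0) :
    nonfree h (rep h w) ≠ 0 := by
  intro hzero
  let mon : (ι →₀ ℕ) → MvPolynomial ι K := fun a => monomial a 1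
  have hadd : ∀ a b, coeff (w + totalExp h (a + b)) (monomial (h j) 1 * E (mon (a + b))) =
      coeff (w + totalExp h a) (monomial (h j) 1 * E (mon a)) +
      coeff (w + totalExp h b) (monomial (h j) 1 * E (mon b)) := by
    intro a b
    have e : mon (a + b) = mon a * mon b := by simp [mon, monomial_mul]
    rw [e, hmul, mul_add, coeff_add, map_add, add_comm]
    congr 1
    · rw [mul_left_comm, monMap_monomial, show w + (totalExp h a + totalExp h b) =
        totalExp h b + (w + totalExp h a) by abel, coeff_monomial_mul, one_mul]
    · rw [mul_left_comm, monMap_monomial, show w + (totalExp h a + totalExp h b) =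
        totalExp h a + (w + totalExp h b) by abel, coeff_monomial_mul, one_mul]
  let δ : (ι →₀ ℕ) →+ K := AddMonoidHom.mk' (fun a =>
    coeff (w + totalExp h a) (monomial (h j) 1 * E (mon a))) hadd
  have hδ : ∀ a, δ a = coeff (w + totalExp h a) (monomial (h j) 1 * E (mon a)) := fun _ => rfl
  have hδj : δ (Finsupp.single j 1) ≠ 0 := by
    rw [hδ, totalExp_single, add_comm, coeff_monomial_mul, one_mul]
    exact hw
  have hδi : ∀ i, ¬ IsFreeGen h i → i ≠ j → δ (Finsupp.single i 1) = 0 := by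
    intro i hi hij
    by_contra hne
    rw [hδ, totalExp_single, coeff_monomial_mul'] at hne
    split_ifs at hne with hle
    · rw [one_mul] at hne
      obtain ⟨b, hb⟩ := hrange _ _ hne
      have hwr := totalExp_rep (hrange _ _ hw)
      have e : totalExp h (rep h w + Finsupp.single i 1) =
          totalExp h (Finsupp.single j 1 + b) := by
        rw [map_add, map_add, hwr, hb, totalExp_single, totalExp_single, add_tsub_cancel_of_le hle]
      obtain ⟨c, -, -, e'⟩ := exists_common_add_nonfree e
      have n1 : nonfree h (rep h w + Finsupp.single i 1) = Finsupp.single i 1 := by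
        rw [nonfree_add, hzero, zero_add, nonfree_single hi]
      have n2 : nonfree h (Finsupp.single j 1 + b) = Finsupp.single j 1 + nonfree h b := by
        rw [nonfree_add, nonfree_single hj]
      rw [n1, n2, totalExp_single] at e'
      have := congrArg (· j) (hh i _ e'.symm)
      simp [hij] at this
    · exact hne rfl
  have hδn : ∀ a, δ (nonfree h a) = a j * δ (Finsupp.single j 1) := by
    intro a
    conv_lhs => rw [← Finsupp.sum_single (nonfree h a), map_finsuppSum]
    have e : ∀ i n, δ (Finsupp.single i n) = n * δ (Finsupp.single i 1) := by
      intro i n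
      rw [← nsmul_eq_mul, ← map_nsmul, Finsupp.smul_single, smul_eq_mul, mul_one]
    rw [Finsupp.sum, Finset.sum_eq_single j, e, nonfree_apply_of_not a hj]
    · intro i hi hij
      by_cases hf : IsFreeGen h i
      · rw [e, nonfree_apply_of a hf, Nat.cast_zero, zero_mul]
      · rw [e, hδi i hf hij, mul_zero]
    · intro hn
      rw [e, Finsupp.notMem_support_iff.1 hn, Nat.cast_zero, zero_mul]
  refine hj fun a b hab => ?_
  obtain ⟨c, -, -, e⟩ := exists_common_add_nonfree hab
  have key : δ (nonfree h a) = δ (nonfree h b) := by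
    have : E (mon (nonfree h a)) = E (mon (nonfree h b)) := by
      rw [← sub_eq_zero, ← map_sub]
      apply hker
      simp [mon, e]
    rw [hδ, hδ, this, e]
  rw [hδn, hδn] at key
  exact_mod_cast mul_right_cancel₀ hδj key

end MonomialMap

namespace MonomialMap

variable {σ ι K : Type*} [Field K]

/-- The homomorphism whose `n`-th coefficient is the homogeneous component of degree `n`. -/
def gradeHom (σ K : Type*) [Field K] : MvPolynomial σ K →ₐ[K] Polynomial (MvPolynomial σ K) :=
  aeval fun i => Polynomial.C (X i) * Polynomial.X

lemma coeff_gradeHom (n : ℕ) (f : MvPolynomial σ K) :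
    (gradeHom σ K f).coeff n = homogeneousComponent n f := by
  induction f using MvPolynomial.induction_on' with
  | monomial a c =>
    have e : gradeHom σ K (monomial a c) =
        Polynomial.C (monomial a c) * Polynomial.X ^ a.degree := by
      rw [gradeHom, aeval_monomial, Finsupp.prod]
      simp only [mul_pow, Finset.prod_mul_distrib, Finset.prod_pow_eq_pow_sum]
      rw [Polynomial.algebraMap_apply, algebraMap_eq, ← mul_assoc, monomial_eq, Finsupp.prod,
        Finsupp.degree_apply, map_mul, map_prod]
      simp only [map_pow]
    rw [e, Polynomial.coeff_C_mul_X_pow,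
      homogeneousComponent_of_mem (m := n) (isHomogeneous_monomial c rfl)]
  | add p q hp hq => rw [map_add, Polynomial.coeff_add, hp, hq, map_add]

lemma homogeneousComponent_one_mul (f g : MvPolynomial σ K) :
    homogeneousComponent 1 (f * g) = C (constantCoeff f) * homogeneousComponent 1 g +
      C (constantCoeff g) * homogeneousComponent 1 f := by
  rw [← coeff_gradeHom, map_mul, Polynomial.mul_coeff_one]
  simp only [coeff_gradeHom, homogeneousComponent_zero, constantCoeff_eq]
  ring

lemma homogeneousComponent_prod {A : ι → MvPolynomial σ K} {a : ι →₀ ℕ}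
    (hA : ∀ i ∈ a.support, constantCoeff (A i) = 0) {m : ℕ} (hm : m ≤ a.degree) :
    homogeneousComponent m (a.prod fun i n => A i ^ n) =
      if m = a.degree then a.prod fun i n => homogeneousComponent 1 (A i) ^ n else 0 := by
  have e : ∀ i ∈ a.support, gradeHom σ K (A i) = (gradeHom σ K (A i)).divX * Polynomial.X := by
    intro i hi
    conv_lhs => rw [← Polynomial.divX_mul_X_add (gradeHom σ K (A i))]
    rw [coeff_gradeHom, homogeneousComponent_zero, ← constantCoeff_eq, hA i hi]
    simp
  have e' : gradeHom σ K (a.prod fun i n => A i ^ n) =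
      (∏ i ∈ a.support, (gradeHom σ K (A i)).divX ^ a i) * Polynomial.X ^ a.degree := by
    rw [Finsupp.prod, map_prod, Finsupp.degree_apply, ← Finset.prod_pow_eq_pow_sum,
      ← Finset.prod_mul_distrib]
    refine Finset.prod_congr rfl fun i hi => ?_
    rw [map_pow, ← mul_pow, ← e i hi]
  rw [← coeff_gradeHom, e', Polynomial.coeff_mul_X_pow']
  split_ifs with h1 h2 h2
  · subst h2
    rw [Nat.sub_self, Polynomial.coeff_zero_eq_eval_zero, Polynomial.eval_prod, Finsupp.prod]
    refine Finset.prod_congr rfl fun i hi => ?_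
    rw [Polynomial.eval_pow, ← Polynomial.coeff_zero_eq_eval_zero, Polynomial.coeff_divX,
      coeff_gradeHom]
  · omega
  · omega
  · rfl

/-- The Euler derivation. -/
def euler (σ K : Type*) [Fintype σ] [Field K] :
    Derivation K (MvPolynomial σ K) (MvPolynomial σ K) :=
  ∑ i, (X i : MvPolynomial σ K) • pderiv i

lemma euler_of_isHomogeneous [Fintype σ] {n : ℕ} {f : MvPolynomial σ K} (hf : f.IsHomogeneous n) :
    euler σ K f = n • f := by
  rw [← hf.sum_X_mul_pderiv, euler, ← Derivation.coeFnAddMonoidHom_apply, map_sum,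
    Finset.sum_apply]
  simp

lemma mem_of_sum_mem {V : Type*} [AddCommGroup V] [Module K V] [CharZero K] (D : V →ₗ[K] V)
    (W : Submodule K V) (hW : ∀ f ∈ W, D f ∈ W) (s : Finset ℕ) (g : ℕ → V)
    (hg : ∀ i, D (g i) = i • g i) (hs : ∑ i ∈ s, g i ∈ W) : ∀ i ∈ s, g i ∈ W := by
  induction s using Finset.induction_on generalizing g with
  | empty => simp
  | insert m s hm ih =>
    have h1 : ∑ i ∈ s, ((i : K) - m) • g i ∈ W := by
      have := sub_mem (hW _ hs) (W.smul_mem (m : K) hs)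
      rw [map_sum, Finset.smul_sum, ← Finset.sum_sub_distrib, Finset.sum_insert hm] at this
      simpa only [hg, ← Nat.cast_smul_eq_nsmul K, ← sub_smul, sub_self, zero_smul, zero_add]
        using this
    have h2 : ∀ i ∈ s, g i ∈ W := by
      intro i hi
      have hne : (i : K) - m ≠ 0 := by
        rw [sub_ne_zero]
        exact fun e => hm (Nat.cast_injective e ▸ hi)
      have := ih (fun i => ((i : K) - m) • g i)
        (fun i => by rw [map_smul, hg, smul_comm]) h1 i hi
      exact (W.smul_mem_iff hne).1 this
    rw [Finset.sum_insert hm] at hs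
    intro i hi
    rcases Finset.mem_insert.1 hi with rfl | hi
    · exact (W.add_mem_iff_left (sum_mem h2)).1 hs
    · exact h2 i hi

lemma homogeneousComponent_mem_of_euler [Fintype σ] [CharZero K]
    (W : Submodule K (MvPolynomial σ K)) (hW : ∀ f ∈ W, euler σ K f ∈ W)
    {f : MvPolynomial σ K} (hf : f ∈ W) (n : ℕ) : homogeneousComponent n f ∈ W := by
  by_cases hn : n ∈ Finset.range (f.totalDegree + 1)
  · refine mem_of_sum_mem (euler σ K).toLinearMap W hW _ (fun i => homogeneousComponent i f)
      (fun i => euler_of_isHomogeneous (homogeneousComponent_isHomogeneous i f)) ?_ n hn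
    rwa [sum_homogeneousComponent]
  · rw [homogeneousComponent_eq_zero]
    · exact W.zero_mem
    · simpa [Nat.lt_succ_iff] using hn

lemma euler_mem [Fintype σ] (W : Submodule K (MvPolynomial σ K)) {f : MvPolynomial σ K}
    (hf : ∀ n, homogeneousComponent n f ∈ W) : euler σ K f ∈ W := by
  rw [← sum_homogeneousComponent f, map_sum]
  refine sum_mem fun n _ => ?_
  rw [euler_of_isHomogeneous (homogeneousComponent_isHomogeneous n f)]
  exact W.nsmul_mem (hf n) n

end MonomialMap

namespace MonomialMap

variable {σ ι τ K : Type*} [Field K]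

/-- A surjective endomorphism of a Noetherian ring is injective. -/
lemma injective_of_surjective_ringEnd {R : Type*} [CommRing R] [IsNoetherianRing R] (F : R →+* R)
    (hF : Function.Surjective F) : Function.Injective F := by
  let k : ℕ →o Ideal R :=
    ⟨fun n => RingHom.ker (F ^ n), monotone_nat_of_le_succ fun n x hx => by
      rw [RingHom.mem_ker] at hx ⊢
      rw [pow_succ', RingHom.mul_def, RingHom.comp_apply, hx, map_zero]⟩
  obtain ⟨n, hn⟩ := monotone_stabilizes_iff_noetherian.2 ‹_› k
  rw [injective_iff_map_eq_zero]
  intro x hx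
  have hsurj : Function.Surjective (F ^ n : R →+* R) := by
    rw [RingHom.coe_pow]
    exact hF.iterate n
  obtain ⟨y, rfl⟩ := hsurj x
  have hy : y ∈ k (n + 1) := by
    change (F ^ (n + 1)) y = 0
    rwa [pow_succ']
  rw [← hn (n + 1) n.le_succ] at hy
  exact hy

lemma linear_aeval_mem_span (A : ι → MvPolynomial σ K) (f : MvPolynomial ι K) :
    homogeneousComponent 1 (aeval A f) ∈
      Submodule.span K (Set.range fun j => homogeneousComponent 1 (A j)) := by
  induction f using MvPolynomial.induction_on with
  | C a =>
    rw [aeval_C, algebraMap_eq, homogeneousComponent_of_mem (isHomogeneous_C σ a),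
      if_neg one_ne_zero]
    exact Submodule.zero_mem _
  | add p q hp hq =>
    rw [map_add, map_add]
    exact add_mem hp hq
  | mul_X p i hp =>
    rw [map_mul, homogeneousComponent_one_mul, aeval_X, ← smul_eq_C_mul, ← smul_eq_C_mul]
    exact add_mem (Submodule.smul_mem _ _ (Submodule.subset_span ⟨i, rfl⟩))
      (Submodule.smul_mem _ _ hp)

/-- A homomorphism `Φ` with homogeneous kernel and the same image as the monomial map of `h`,
together with lifts `A` of the generators and expressions `P` of the images of the variables. -/
structure IsLift (Φ : MvPolynomial σ K →ₐ[K] MvPolynomial τ K) (h : ι → τ →₀ ℕ)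
    (A : ι → MvPolynomial σ K) (P : σ → MvPolynomial ι K) : Prop where
  minimal : IsMinimalGen h
  map_gen : ∀ j, Φ (A j) = monomial (h j) 1
  map_var : ∀ i, monMap K h (P i) = Φ (X i)
  homog : ∀ f, Φ f = 0 → ∀ n, Φ (homogeneousComponent n f) = 0

namespace IsLift

variable {Φ : MvPolynomial σ K →ₐ[K] MvPolynomial τ K} {h : ι → τ →₀ ℕ}
  {A : ι → MvPolynomial σ K} {P : σ → MvPolynomial ι K} (H : IsLift Φ h A P)

include H

lemma map_aeval_gen (f : MvPolynomial ι K) : Φ (aeval A f) = monMap K h f := by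
  have : Φ.comp (aeval A) = monMap K h := by
    ext i : 1
    simp [H.map_gen]
  exact DFunLike.congr_fun this f

lemma monMap_aeval_var (f : MvPolynomial σ K) : monMap K h (aeval P f) = Φ f := by
  have : (monMap K h).comp (aeval P) = Φ := by
    ext i : 1
    simp [H.map_var]
  exact DFunLike.congr_fun this f

lemma constantCoeff_eq_zero {f : MvPolynomial σ K} (hf : Φ f = 0) : constantCoeff f = 0 := by
  have := H.homog f hf 0
  rw [homogeneousComponent_zero, ← algebraMap_eq, AlgHom.commutes] at this
  rw [constantCoeff_eq]
  exact (map_eq_zero_iff _ (algebraMap K (MvPolynomial τ K)).injective).1 this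

lemma constantCoeff_gen_eq_zero [Fintype σ] [CharZero K] {j : ι} (hj : ¬ IsFreeGen h j) :
    constantCoeff (A j) = 0 := by
  let I : Ideal (MvPolynomial σ K) :=
    Ideal.span ((RingHom.ker Φ : Set (MvPolynomial σ K)) ∪ A '' {i | ¬ IsFreeGen h i})
  have hker : ∀ f, Φ f = 0 → f ∈ I := fun f hf => Ideal.subset_span (Or.inl hf)
  have hgen : ∀ i, ¬ IsFreeGen h i → A i ∈ I := fun i hi =>
    Ideal.subset_span (Or.inr ⟨i, hi, rfl⟩)
  have hΦeuler : ∀ f, Φ f = 0 → Φ (euler σ K f) = 0 := fun f hf =>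
    euler_mem (LinearMap.ker Φ.toLinearMap) (H.homog f hf)
  let E : MvPolynomial ι K →ₗ[K] MvPolynomial τ K :=
    Φ.toLinearMap ∘ₗ (euler σ K).toLinearMap ∘ₗ (aeval A).toLinearMap
  have hE : ∀ f, E f = Φ (euler σ K (aeval A f)) := fun _ => rfl
  have hErange : ∀ f w, coeff w (E f) ≠ 0 → w ∈ Set.range (totalExp h) := by
    intro f w hw
    by_contra hn
    rw [hE, ← H.monMap_aeval_var] at hw
    exact hw (coeff_monMap_eq_zero hn)
  have hEgen : ∀ {i}, ¬ IsFreeGen h i → ∀ {w}, coeff w (E (X i)) ≠ 0 →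
      nonfree h (rep h w) ≠ 0 := by
    intro i hi w hw
    refine nonfree_rep_ne_zero H.minimal E ?_ ?_ hErange hi hw
    · intro f g
      simp only [hE, map_mul, Derivation.leibniz, smul_eq_mul, map_add, H.map_aeval_gen]
    · intro f hf
      rw [hE]
      exact hΦeuler _ (by rw [H.map_aeval_gen, hf])
  have hAeuler : ∀ i, ¬ IsFreeGen h i → euler σ K (A i) ∈ I := by
    intro i hi
    set g := aeval P (euler σ K (A i)) with hg
    have hEX : E (X i) = monMap K h g := by rw [hg, H.monMap_aeval_var, hE, aeval_X]
    have h1 : aeval A (repMap K h (monMap K h g)) ∈ I := by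
      rw [(monMap K h g).as_sum, map_sum, map_sum]
      refine sum_mem fun w hw => ?_
      rw [repMap_monomial, aeval_monomial]
      rw [mem_support_iff, ← hEX] at hw
      obtain ⟨m, hm⟩ := Finsupp.ne_iff.1 (hEgen hi hw)
      have hmn : ¬ IsFreeGen h m := fun hf => hm (by simp [nonfree_apply_of _ hf])
      rw [nonfree_apply_of_not _ hmn, Finsupp.zero_apply] at hm
      refine Ideal.mul_mem_left _ _ (Ideal.mem_of_dvd _ ?_ (hgen m hmn))
      exact (dvd_pow_self _ hm).trans
        (Finset.dvd_prod_of_mem (fun i => A i ^ rep h w i) (Finsupp.mem_support_iff.2 hm))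
    have h2 : euler σ K (A i) - aeval A (repMap K h (monMap K h g)) ∈ I := by
      apply hker
      have : monMap K h (g - repMap K h (monMap K h g)) = 0 := by
        rw [← RingHom.mem_ker, ker_monMap]
        exact sub_repMap_mem g
      rw [map_sub, sub_eq_zero] at this
      rw [map_sub, H.map_aeval_gen, ← this, hg, H.monMap_aeval_var, sub_self]
    simpa using add_mem h2 h1
  have hstable : ∀ f ∈ I, euler σ K f ∈ I := by
    intro f hf
    refine Submodule.span_induction ?_ (by simp) ?_ ?_ hf
    · rintro x (hx | ⟨i, hi, rfl⟩)
      · exact hker _ (hΦeuler x hx)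
      · exact hAeuler i hi
    · intro x y _ _ hx hy
      rw [map_add]
      exact add_mem hx hy
    · intro r x hx' hx
      rw [smul_eq_mul, Derivation.leibniz, smul_eq_mul, smul_eq_mul]
      exact add_mem (Ideal.mul_mem_left _ _ hx) (Ideal.mul_mem_right _ _ hx')
  have hconst : C (constantCoeff (A j)) ∈ I := by
    have := homogeneousComponent_mem_of_euler (I.restrictScalars K) hstable (hgen j hj) 0
    rwa [homogeneousComponent_zero] at this
  have hle : I ≤ RingHom.ker ((constantCoeff : MvPolynomial τ K →+* K).comp
      (Φ : MvPolynomial σ K →+* MvPolynomial τ K)) := by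
    rw [Ideal.span_le]
    rintro x (hx | ⟨i, hi, rfl⟩)
    · have hx : Φ x = 0 := hx
      simp [hx]
    · have : constantCoeff (monomial (h i) (1 : K)) = 0 := by
        rw [constantCoeff_monomial, if_neg (H.minimal.ne_zero i)]
      simp [H.map_gen, this]
  have := hle hconst
  rw [RingHom.mem_ker, ← algebraMap_eq, RingHom.comp_apply, RingHom.coe_coe,
    AlgHom.commutes, algebraMap_eq, constantCoeff_C] at this
  exact this

lemma map_prod_linear_eq [Fintype σ] [CharZero K]
    (hne : ∀ j, Φ (homogeneousComponent 1 (A j)) ≠ 0) {a b : ι →₀ ℕ}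
    (hab : totalExp h a = totalExp h b) :
    Φ (a.prod fun j n => homogeneousComponent 1 (A j) ^ n) =
      Φ (b.prod fun j n => homogeneousComponent 1 (A j) ^ n) := by
  have hzero : ∀ a : ι →₀ ℕ, ∀ j ∈ (nonfree h a).support, constantCoeff (A j) = 0 := by
    intro a j hj
    refine H.constantCoeff_gen_eq_zero fun hf => ?_
    rw [Finsupp.mem_support_iff, nonfree_apply_of a hf] at hj
    exact hj rfl
  have hprod : ∀ a : ι →₀ ℕ, Φ (a.prod fun j n => homogeneousComponent 1 (A j) ^ n) ≠ 0 := by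
    intro a
    rw [Finsupp.prod, map_prod]
    refine Finset.prod_ne_zero_iff.2 fun j _ => ?_
    rw [map_pow]
    exact pow_ne_zero _ (hne j)
  have hlt : ∀ a b : ι →₀ ℕ, totalExp h (nonfree h a) = totalExp h (nonfree h b) →
      (nonfree h a).degree ≤ (nonfree h b).degree →
      Φ ((nonfree h a).prod fun j n => homogeneousComponent 1 (A j) ^ n) =
        Φ (if (nonfree h a).degree = (nonfree h b).degree then
          ((nonfree h b).prod fun j n => homogeneousComponent 1 (A j) ^ n) else 0) := by
    intro a b hab hle
    have h1 : Φ (((nonfree h a).prod fun j n => A j ^ n) -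
        ((nonfree h b).prod fun j n => A j ^ n)) = 0 := by
      have := congrArg (fun w => monomial w (1 : K)) hab
      simp only [← monMap_monomial, ← H.map_aeval_gen, aeval_monomial, map_one, one_mul] at this
      rw [map_sub, this, sub_self]
    have h2 := H.homog _ h1 (nonfree h a).degree
    rw [map_sub, homogeneousComponent_prod (hzero a) le_rfl,
      homogeneousComponent_prod (hzero b) hle, if_pos rfl, map_sub, sub_eq_zero] at h2
    exact h2
  obtain ⟨c, ha, hb, e⟩ := exists_common_add_nonfree hab
  have hdeg : ∀ a b : ι →₀ ℕ, totalExp h (nonfree h a) = totalExp h (nonfree h b) →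
      (nonfree h a).degree ≤ (nonfree h b).degree →
      (nonfree h a).degree = (nonfree h b).degree := by
    intro a b hab hle
    by_contra hn
    have := hlt a b hab hle
    rw [if_neg hn, map_zero] at this
    exact hprod _ this
  have hd : (nonfree h a).degree = (nonfree h b).degree :=
    (le_total (nonfree h a).degree (nonfree h b).degree).elim (hdeg a b e)
      fun hle => (hdeg b a e.symm hle).symm
  have := hlt a b e hd.le
  rw [if_pos hd] at this
  rw [ha, hb, Finsupp.prod_add_index' (by simp) (by simp [pow_add]),
    Finsupp.prod_add_index' (by simp) (by simp [pow_add]), map_mul, map_mul, this]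

/-- Coordinate functionals on the cotangent space at the origin. -/
lemma exists_dual [Fintype σ] [CharZero K] (j : ι) :
    ∃ t : MvPolynomial σ K →ₗ[K] K, (∀ f, Φ f = 0 → t f = 0) ∧
      ∀ i, t (homogeneousComponent 1 (A i)) = if i = j then 1 else 0 := by
  let c : ι → K := fun i => constantCoeff (A i)
  have hc : ∀ f : MvPolynomial ι K, aeval c f = constantCoeff (aeval A f) := by
    intro f
    have : (constantCoeff : MvPolynomial σ K →+* K).comp
        (aeval A : MvPolynomial ι K →ₐ[K] MvPolynomial σ K).toRingHom =
        (aeval c : MvPolynomial ι K →ₐ[K] K).toRingHom := by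
      ext i <;> simp [c]
    exact (DFunLike.congr_fun this f).symm
  have hker0 : ∀ f, monMap K h f = 0 → aeval c f = 0 := by
    intro f hf
    rw [hc]
    exact H.constantCoeff_eq_zero (by rw [H.map_aeval_gen, hf])
  let θ : MvPolynomial ι K →ₗ[K] K := (aeval c).toLinearMap ∘ₗ (pderiv j).toLinearMap
  have hθ : ∀ f, θ f = aeval c (pderiv j f) := fun _ => rfl
  have hθmul : ∀ f g, θ (f * g) = aeval c f * θ g + aeval c g * θ f := by
    intro f g
    simp only [hθ, Derivation.leibniz, smul_eq_mul, map_add, map_mul]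
  have hθmon : ∀ a : ι →₀ ℕ, nonfree h a ≠ Finsupp.single j 1 →
      θ (monomial (nonfree h a) 1) = 0 := by
    intro a ha
    rw [hθ, pderiv_monomial, aeval_monomial]
    by_cases hz : nonfree h a j = 0
    · simp [hz]
    · have hne : nonfree h a - Finsupp.single j 1 ≠ 0 := by
        intro e
        apply ha
        refine le_antisymm (tsub_eq_zero_iff_le.1 e) ?_
        rw [Finsupp.single_le_iff]
        exact Nat.one_le_iff_ne_zero.2 hz
      obtain ⟨i, hi⟩ := Finsupp.ne_iff.1 hne
      have hin : ¬ IsFreeGen h i := by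
        intro hf
        apply hi
        rw [Finsupp.tsub_apply, nonfree_apply_of a hf]
        simp
      rw [Finsupp.prod, Finset.prod_eq_zero (Finsupp.mem_support_iff.2 hi), mul_zero]
      rw [show c i = 0 from H.constantCoeff_gen_eq_zero hin, zero_pow hi]
  have hθker : ∀ f, monMap K h f = 0 → θ f = 0 := by
    intro f hf
    rw [← RingHom.mem_ker, ker_monMap] at hf
    refine Submodule.span_induction ?_ (map_zero θ) ?_ ?_ hf
    · rintro _ ⟨a, b, hab, rfl⟩
      obtain ⟨d, ha, hb, e⟩ := exists_common_add_nonfree hab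
      have e1 : (monomial a 1 - monomial b 1 : MvPolynomial ι K) = monomial d 1 *
          (monomial (nonfree h a) 1 - monomial (nonfree h b) 1) := by
        rw [mul_sub, monomial_mul, monomial_mul, ← ha, ← hb, one_mul]
      have e2 : θ (monomial (nonfree h a) 1 - monomial (nonfree h b) 1) = 0 := by
        by_cases h1 : nonfree h a = Finsupp.single j 1
        · have h2 : nonfree h b = Finsupp.single j 1 :=
            H.minimal j _ (by rw [← e, h1, totalExp_single])
          rw [h1, h2, sub_self, map_zero]
        · have h2 : nonfree h b ≠ Finsupp.single j 1 := fun h2 =>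
            h1 (H.minimal j _ (by rw [e, h2, totalExp_single]))
          rw [map_sub, hθmon a h1, hθmon b h2, sub_self]
      rw [e1, hθmul, e2, hker0 (monomial (nonfree h a) 1 - monomial (nonfree h b) 1) (by simp [e]),
        mul_zero, zero_mul, add_zero]
    · intro x y _ _ hx hy
      rw [map_add, hx, hy, add_zero]
    · intro r x hx' hx
      have hx' : monMap K h x = 0 := by
        rw [← RingHom.mem_ker, ker_monMap]
        exact hx'
      rw [smul_eq_mul, hθmul, hx, hker0 x hx', mul_zero, zero_mul, add_zero]
  let t : MvPolynomial σ K →ₗ[K] K := θ ∘ₗ (aeval P).toLinearMap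
  have ht : ∀ f, t f = θ (aeval P f) := fun _ => rfl
  have hcP : ∀ f, aeval c (aeval P f) = constantCoeff f := by
    intro f
    rw [hc, ← sub_eq_zero, ← map_sub]
    apply H.constantCoeff_eq_zero
    rw [map_sub, H.map_aeval_gen, H.monMap_aeval_var, sub_self]
  have hlin : ∀ f, t (homogeneousComponent 1 f) = t f := by
    intro f
    induction f using MvPolynomial.induction_on with
    | C a =>
      rw [homogeneousComponent_of_mem (isHomogeneous_C σ a), if_neg one_ne_zero, map_zero, ht,
        hθ]
      simp [algHom_C]
    | add p q hp hq => rw [map_add, map_add, map_add, hp, hq]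
    | mul_X p i hp =>
      have hX : homogeneousComponent 1 (X i : MvPolynomial σ K) = X i :=
        homogeneousComponent_eq_self (isHomogeneous_X K i)
      rw [homogeneousComponent_one_mul, hX, constantCoeff_X, C_0, zero_mul, add_zero,
        ← smul_eq_C_mul, map_smul, smul_eq_mul, ht (p * X i), map_mul, hθmul, hcP, hcP,
        constantCoeff_X, zero_mul, add_zero, ht]
  refine ⟨t, fun f hf => hθker (aeval P f) (by rw [H.monMap_aeval_var, hf]), fun i => ?_⟩
  have e : θ (aeval P (A i)) = θ (X i) := by
    rw [← sub_eq_zero, ← map_sub]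
    apply hθker
    rw [map_sub, H.monMap_aeval_var, H.map_gen, monMap_X, sub_self]
  rw [hlin, ht, e, hθ, pderiv_X]
  by_cases hij : i = j
  · subst hij; simp
  · simp [hij]

lemma exists_linear_mem_span (i : σ) :
    ∃ g ∈ Submodule.span K (Set.range fun j => homogeneousComponent 1 (A j)),
      Φ (X i - g) = 0 := by
  refine ⟨_, linear_aeval_mem_span A (P i), ?_⟩
  have hX : homogeneousComponent 1 (X i : MvPolynomial σ K) = X i :=
    homogeneousComponent_eq_self (isHomogeneous_X K i)
  have := H.homog (X i - aeval A (P i))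
    (by rw [map_sub, H.map_aeval_gen, H.map_var, sub_self]) 1
  rwa [map_sub, hX] at this

/-- The linear parts of the lifts satisfy exactly the relations of the generators. -/
lemma map_aeval_linear_eq_zero_iff [Fintype σ] [CharZero K] [Finite ι] (f : MvPolynomial ι K) :
    Φ (aeval (fun j => homogeneousComponent 1 (A j)) f) = 0 ↔ f ∈ binomialIdeal K h := by
  set N : MvPolynomial ι K →ₐ[K] MvPolynomial ι K :=
    (aeval P).comp (aeval fun j => homogeneousComponent 1 (A j)) with hN
  have hNf : ∀ f, monMap K h (N f) = Φ (aeval (fun j => homogeneousComponent 1 (A j)) f) :=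
    fun f => H.monMap_aeval_var _
  have hne : ∀ j, Φ (homogeneousComponent 1 (A j)) ≠ 0 := by
    intro j h0
    obtain ⟨t, ht, ht'⟩ := H.exists_dual j
    have := ht _ h0
    rw [ht', if_pos rfl] at this
    exact one_ne_zero this
  have hle : binomialIdeal K h ≤ (RingHom.ker (monMap K h)).comap N := by
    rw [binomialIdeal, Ideal.span_le]
    rintro _ ⟨a, b, hab, rfl⟩
    have := H.map_prod_linear_eq hne hab
    rw [SetLike.mem_coe, Ideal.mem_comap, RingHom.mem_ker, hNf, map_sub, map_sub, aeval_monomial,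
      aeval_monomial, map_one, one_mul, one_mul, this, sub_self]
  rw [← ker_monMap] at hle ⊢
  rw [← hNf, RingHom.mem_ker]
  refine ⟨fun hf => ?_, fun hf => hle hf⟩
  have hsurj : ∀ g, ∃ g', monMap K h (N g') = monMap K h g := by
    have hr : Φ.range ≤ (Φ.comp (aeval fun j => homogeneousComponent 1 (A j))).range := by
      rw [← Algebra.map_top, ← adjoin_range_X, AlgHom.map_adjoin, Algebra.adjoin_le_iff]
      rintro _ ⟨_, ⟨i, rfl⟩, rfl⟩
      obtain ⟨g, hg, hg'⟩ := H.exists_linear_mem_span i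
      rw [map_sub, sub_eq_zero] at hg'
      rw [hg']
      have : Submodule.span K (Set.range fun j => homogeneousComponent 1 (A j)) ≤
          (aeval fun j => homogeneousComponent 1 (A j)).range.toSubmodule := by
        rw [Submodule.span_le]
        rintro _ ⟨j, rfl⟩
        exact ⟨X j, by simp⟩
      obtain ⟨g', rfl⟩ := this hg
      exact ⟨g', rfl⟩
    intro g
    obtain ⟨g', hg'⟩ := hr ⟨aeval A g, rfl⟩
    refine ⟨g', ?_⟩
    rw [hNf, ← H.map_aeval_gen]
    exact hg'
  let Q := MvPolynomial ι K ⧸ RingHom.ker (monMap K h)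
  let F : Q →+* Q := Ideal.quotientMap _ (N : MvPolynomial ι K →+* MvPolynomial ι K) hle
  have hFmk : ∀ g, F (Ideal.Quotient.mk _ g) = Ideal.Quotient.mk _ (N g) := fun _ => rfl
  have hF : Function.Surjective F := by
    intro q
    obtain ⟨g, rfl⟩ := Ideal.Quotient.mk_surjective q
    obtain ⟨g', hg'⟩ := hsurj g
    refine ⟨Ideal.Quotient.mk _ g', ?_⟩
    rw [hFmk, Ideal.Quotient.eq, RingHom.mem_ker, map_sub, sub_eq_zero]
    exact hg'
  have hFinj := injective_of_surjective_ringEnd F hF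
  have h0 : F (Ideal.Quotient.mk _ f) = 0 := by
    rw [hFmk, Ideal.Quotient.eq_zero_iff_mem, RingHom.mem_ker]
    exact hf
  exact RingHom.mem_ker.1 (Ideal.Quotient.eq_zero_iff_mem.1 (hFinj (h0.trans (map_zero F).symm)))

end IsLift

end MonomialMap

namespace MonomialMap

variable {σ ι τ K : Type*} [Field K]

lemma range_monMap (h : ι → τ →₀ ℕ) :
    (monMap K h).range =
      Algebra.adjoin K (Set.range fun i => (monomial (h i) 1 : MvPolynomial τ K)) :=
  (Algebra.adjoin_range_eq_range_aeval K _).symm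

/-- An algebra generated by finitely many monomials has a minimal set of monomial generators. -/
lemma exists_minimalGen (M : Finset (τ →₀ ℕ)) :
    ∃ M' : Finset (τ →₀ ℕ), IsMinimalGen (fun m : M' => (m : τ →₀ ℕ)) ∧
      (monMap K fun m : M' => (m : τ →₀ ℕ)).range =
        Algebra.adjoin K ((fun a => (monomial a 1 : MvPolynomial τ K)) '' M) := by
  let S : Finset (τ →₀ ℕ) → Subalgebra K (MvPolynomial τ K) := fun N =>
    Algebra.adjoin K ((fun a => (monomial a 1 : MvPolynomial τ K)) '' N)
  obtain ⟨M', -, hM'⟩ :=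
    exists_minimal_le_of_wellFoundedLT (fun N => S N = S M) M rfl
  have hmon : ∀ {N : Finset (τ →₀ ℕ)} {m}, m ∈ N → monomial m 1 ∈ S N := fun hm =>
    Algebra.subset_adjoin ⟨_, hm, rfl⟩
  have herase : ∀ m ∈ M', monomial m 1 ∉ S (M'.erase m) := by
    intro m hm hmem
    have hle : S M' ≤ S (M'.erase m) := by
      refine Algebra.adjoin_le ?_
      rintro _ ⟨m', hm', rfl⟩
      by_cases e : m' = m
      · rw [e]; exact hmem
      · exact hmon (Finset.mem_erase.2 ⟨e, hm'⟩)
    have hge : S (M'.erase m) ≤ S M' :=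
      Algebra.adjoin_mono (Set.image_mono (Finset.coe_subset.2 (Finset.erase_subset m M')))
    have h1 := hM'.2 (y := M'.erase m) (show S _ = S M by
      rw [← show S M' = S M from hM'.1]; exact le_antisymm hge hle) (Finset.erase_subset m M')
    exact Finset.notMem_erase m M' (h1 hm)
  have hzero : ∀ m ∈ M', m ≠ 0 := by
    rintro m hm rfl
    exact herase 0 hm (one_mem (S _))
  refine ⟨M', ?_, ?_⟩
  · intro i a ha
    by_cases hai : a i = 0
    · exfalso
      apply herase i i.2
      have hmi : monomial (i : τ →₀ ℕ) (1 : K) = _ :=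
        (congrArg (fun w => monomial w (1 : K)) ha).symm
      rw [hmi, ← monMap_monomial (K := K), monMap, aeval_monomial, map_one, one_mul]
      refine prod_mem fun j hj => pow_mem (hmon (Finset.mem_erase.2 ⟨?_, j.2⟩)) _
      intro e
      rw [Subtype.ext e] at hj
      exact (Finsupp.mem_support_iff.1 hj) hai
    · have hle : Finsupp.single i 1 ≤ a := by
        rw [Finsupp.single_le_iff]; omega
      have h1 : totalExp (fun m : M' => (m : τ →₀ ℕ)) (a - Finsupp.single i 1) = 0 := by
        have := congrArg (totalExp fun m : M' => (m : τ →₀ ℕ)) (tsub_add_cancel_of_le hle)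
        rw [map_add, totalExp_single, ha] at this
        exact add_eq_right.1 this
      have h2 : a - Finsupp.single i 1 = 0 := by
        ext j
        by_contra hj
        have hle' : Finsupp.single j 1 ≤ a - Finsupp.single i 1 := by
          rw [Finsupp.single_le_iff]
          exact Nat.one_le_iff_ne_zero.2 hj
        have := congrArg (totalExp fun m : M' => (m : τ →₀ ℕ)) (tsub_add_cancel_of_le hle')
        rw [map_add, totalExp_single, h1] at this
        exact hzero j j.2 (add_eq_zero.1 this).2
      rw [← tsub_add_cancel_of_le hle, h2, zero_add]
  · rw [range_monMap]
    refine Eq.trans ?_ hM'.1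
    change _ = Algebra.adjoin K _
    congr 1
    ext f
    simp

namespace IsLift

variable {Φ : MvPolynomial σ K →ₐ[K] MvPolynomial τ K} {h : ι → τ →₀ ℕ}
  {A : ι → MvPolynomial σ K} {P : σ → MvPolynomial ι K} (H : IsLift Φ h A P)

include H

lemma eq_zero_of_mem_span [Fintype σ] [CharZero K] {f : MvPolynomial σ K}
    (hf : f ∈ Submodule.span K (Set.range fun j => homogeneousComponent 1 (A j)))
    (h0 : Φ f = 0) : f = 0 := by
  obtain ⟨c, rfl⟩ := Finsupp.mem_span_range_iff_exists_finsupp.1 hf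
  have hc : c = 0 := by
    ext j
    obtain ⟨t, ht, htA⟩ := H.exists_dual j
    have := ht _ h0
    rw [map_finsuppSum] at this
    simpa [htA, Finsupp.sum_ite_eq'] using this
  rw [hc, Finsupp.sum_zero_index]

lemma linearIndependent_linear [Fintype σ] [CharZero K] :
    LinearIndependent K fun j => homogeneousComponent 1 (A j) := by
  rw [linearIndependent_iff]
  intro c hc
  ext j
  obtain ⟨t, -, htA⟩ := H.exists_dual j
  have := congrArg t hc
  rw [Finsupp.linearCombination_apply, map_finsuppSum, map_zero] at this
  simpa [htA, Finsupp.sum_ite_eq'] using this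

/-- The linear parts of the lifts, completed to a basis of the linear forms, are coordinates
in which the kernel is generated by binomials. -/
theorem exists_linear_forms [Fintype σ] [CharZero K] [Finite ι] (hΦ : ∃ i, Φ (X i) ≠ 0) :
    ∃ L : σ → MvPolynomial σ K, (∀ i, (L i).IsHomogeneous 1) ∧ LinearIndependent K L ∧
      ∃ B : Set (MvPolynomial σ K),
        (∀ f ∈ B, ∃ a b : σ → ℕ, f = (∏ i, L i ^ a i) - ∏ i, L i ^ b i) ∧
        RingHom.ker Φ = Ideal.span B := by
  set l : ι → MvPolynomial σ K := fun j => homogeneousComponent 1 (A j) with hl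
  have hlhom : ∀ j, (l j).IsHomogeneous 1 := fun j => homogeneousComponent_isHomogeneous 1 (A j)
  obtain ⟨j₀⟩ : Nonempty ι := by
    by_contra hι
    rw [not_nonempty_iff] at hι
    obtain ⟨i, hi⟩ := hΦ
    obtain ⟨g, hg, hg'⟩ := H.exists_linear_mem_span i
    rw [Set.range_eq_empty, Submodule.span_empty, Submodule.mem_bot] at hg
    exact hi (by rwa [hg, sub_zero] at hg')
  let V : Submodule K (MvPolynomial σ K) := Submodule.span K (Set.range X)
  have hV : ∀ {f : MvPolynomial σ K}, f ∈ V ↔ f.IsHomogeneous 1 := by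
    intro f
    rw [← mem_homogeneousSubmodule, homogeneousSubmodule_one_eq_span_X]
  have : FiniteDimensional K V := FiniteDimensional.span_of_finite K (Set.finite_range X)
  let W : Submodule K (MvPolynomial σ K) := V ⊓ LinearMap.ker Φ.toLinearMap
  have : FiniteDimensional K W := Submodule.finiteDimensional_of_le inf_le_left
  let bW := Module.finBasis K W
  let w : Fin (Module.finrank K W) → MvPolynomial σ K := fun k => bW k
  have hwΦ : ∀ k, Φ (w k) = 0 := fun k => (bW k).2.2
  have hwhom : ∀ k, (w k).IsHomogeneous 1 := fun k => hV.1 (bW k).2.1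
  have hwspan : Submodule.span K (Set.range w) = W := by
    have := congrArg (Submodule.map W.subtype) bW.span_eq
    rwa [Submodule.map_span, Submodule.map_top, Submodule.range_subtype, ← Set.range_comp] at this
  have hli : LinearIndependent K (Sum.elim l w) := by
    refine H.linearIndependent_linear.sum_type
      (bW.linearIndependent.map' W.subtype W.ker_subtype) ?_
    rw [Submodule.disjoint_def]
    intro f hf hf'
    exact H.eq_zero_of_mem_span hf (hwspan.le hf').2
  have hspan : Submodule.span K (Set.range (Sum.elim l w)) = V := by
    refine le_antisymm (Submodule.span_le.2 ?_) (Submodule.span_le.2 ?_)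
    · rintro _ ⟨j | k, rfl⟩
      · exact hV.2 (hlhom j)
      · exact hV.2 (hwhom k)
    · rintro _ ⟨i, rfl⟩
      obtain ⟨g, hg, hg'⟩ := H.exists_linear_mem_span i
      rw [Set.Sum.elim_range, Submodule.span_union, hwspan]
      have hgV : g ∈ V := by
        refine Submodule.span_le.2 ?_ hg
        rintro _ ⟨j, rfl⟩
        exact hV.2 (hlhom j)
      rw [← add_sub_cancel g (X i)]
      exact Submodule.add_mem_sup hg
        ⟨sub_mem (Submodule.subset_span ⟨i, rfl⟩) hgV, hg'⟩
  let e : σ ≃ ι ⊕ Fin (Module.finrank K W) :=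
    ((Module.Basis.span (linearIndependent_X σ K)).map
      (LinearEquiv.ofEq _ _ hspan.symm)).indexEquiv (Module.Basis.span hli)
  let v : ι ⊕ Fin (Module.finrank K W) → MvPolynomial σ K := Sum.elim l fun k => l j₀ + w k
  let L : σ → MvPolynomial σ K := fun i => v (e i)
  have hLe : ∀ s, L (e.symm s) = v s := fun s => congrArg v (e.apply_symm_apply s)
  have hLmem : ∀ s, v s ∈ Submodule.span K (Set.range L) := fun s =>
    Submodule.subset_span ⟨e.symm s, hLe s⟩
  have hLspan : Submodule.span K (Set.range L) = V := by
    refine le_antisymm (Submodule.span_le.2 ?_) (hspan ▸ Submodule.span_le.2 ?_)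
    · rintro _ ⟨i, rfl⟩
      obtain ⟨s, hs⟩ : ∃ s, s = e i := ⟨_, rfl⟩
      change v (e i) ∈ V
      rw [← hs]
      rcases s with j | k
      · exact hV.2 (hlhom j)
      · exact hV.2 ((hlhom j₀).add (hwhom k))
    · rintro _ ⟨j | k, rfl⟩
      · exact hLmem (Sum.inl j)
      · have := sub_mem (hLmem (Sum.inr k)) (hLmem (Sum.inl j₀))
        simpa [v] using this
  have hLker : ∀ a : ι →₀ ℕ, ∃ a' : σ → ℕ, aeval l (monomial a (1 : K)) = ∏ i, L i ^ a' i := by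
    intro a
    have : Fintype ι := Fintype.ofFinite ι
    refine ⟨fun i => Sum.elim a 0 (e i), ?_⟩
    rw [aeval_monomial, map_one, one_mul,
      e.prod_comp (fun s => v s ^ (Sum.elim a 0 s : ℕ)), Fintype.prod_sum_type,
      Finsupp.prod_fintype _ _ (fun _ => pow_zero _)]
    simp [v]
  let B : Set (MvPolynomial σ K) :=
    {f | Φ f = 0 ∧ ∃ a b : σ → ℕ, f = (∏ i, L i ^ a i) - ∏ i, L i ^ b i}
  refine ⟨L, fun i => hV.1 (hLspan ▸ Submodule.subset_span ⟨i, rfl⟩), ?_, B, fun f hf => hf.2, ?_⟩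
  · rw [linearIndependent_iff_card_eq_finrank_span, Set.finrank, hLspan]
    exact linearIndependent_iff_card_eq_finrank_span.1 (linearIndependent_X σ K)
  have hWB : ∀ f ∈ W, f ∈ Ideal.span B := by
    intro f hf
    rw [← hwspan] at hf
    suffices h : Submodule.span K (Set.range w) ≤ (Ideal.span B).restrictScalars K from h hf
    rw [Submodule.span_le]
    rintro _ ⟨k, rfl⟩
    refine Ideal.subset_span ⟨hwΦ k, Pi.single (e.symm (Sum.inr k)) 1,
      Pi.single (e.symm (Sum.inl j₀)) 1, ?_⟩
    simp [Pi.single_apply, pow_ite, hLe, v]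
  have hmod : ∀ f, ∃ g : MvPolynomial ι K, f - aeval l g ∈ Ideal.span B := by
    intro f
    induction f using MvPolynomial.induction_on with
    | C a => exact ⟨C a, by rw [algHom_C, algebraMap_eq, sub_self]; exact zero_mem _⟩
    | add p q hp hq =>
      obtain ⟨g, hg⟩ := hp
      obtain ⟨g', hg'⟩ := hq
      refine ⟨g + g', ?_⟩
      rw [map_add, add_sub_add_comm]
      exact add_mem hg hg'
    | mul_X p i hp =>
      obtain ⟨g, hg⟩ := hp
      obtain ⟨x, hx, hx'⟩ := H.exists_linear_mem_span i
      obtain ⟨c, hc⟩ := Finsupp.mem_span_range_iff_exists_finsupp.1 hx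
      have hxV : x ∈ V := by
        refine Submodule.span_le.2 ?_ hx
        rintro _ ⟨j, rfl⟩
        exact hV.2 (hlhom j)
      have hxB : X i - x ∈ Ideal.span B :=
        hWB _ ⟨sub_mem (Submodule.subset_span ⟨i, rfl⟩) hxV, hx'⟩
      have hxl : aeval l (c.sum fun j r => r • (X j : MvPolynomial ι K)) = x := by
        rw [map_finsuppSum, ← hc]
        simp [hl]
      refine ⟨g * c.sum fun j r => r • X j, ?_⟩
      rw [map_mul, hxl, show p * X i - aeval l g * x =
        (p - aeval l g) * X i + aeval l g * (X i - x) by ring]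
      exact add_mem (Ideal.mul_mem_right _ _ hg) (Ideal.mul_mem_left _ _ hxB)
  have hBle : Ideal.span B ≤ RingHom.ker Φ := Ideal.span_le.2 fun f hf => hf.1
  refine le_antisymm (fun f hf => ?_) hBle
  obtain ⟨g, hg⟩ := hmod f
  have hg0 : Φ (aeval l g) = 0 := by
    have := hBle hg
    rw [RingHom.mem_ker, map_sub, RingHom.mem_ker.1 hf, zero_sub, neg_eq_zero] at this
    exact this
  have hgB : binomialIdeal K h ≤ (Ideal.span B).comap (aeval l : MvPolynomial ι K →ₐ[K] _) := by
    rw [binomialIdeal, Ideal.span_le]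
    rintro _ ⟨a, b, hab, rfl⟩
    refine Ideal.subset_span ⟨(H.map_aeval_linear_eq_zero_iff _).2
      (Ideal.subset_span ⟨a, b, hab, rfl⟩), ?_⟩
    obtain ⟨a', ha'⟩ := hLker a
    obtain ⟨b', hb'⟩ := hLker b
    exact ⟨a', b', by rw [map_sub, ha', hb']⟩
  have := hgB ((H.map_aeval_linear_eq_zero_iff g).1 hg0)
  rw [← sub_add_cancel f (aeval l g)]
  exact add_mem hg this

end IsLift

/-- A homogeneous presentation of a monomial algebra that does not kill all the variables is
given by binomials in suitable linear coordinates. -/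
theorem exists_linear_forms_of_range_eq [Fintype σ] [CharZero K]
    (Φ : MvPolynomial σ K →ₐ[K] MvPolynomial τ K) (M : Finset (τ →₀ ℕ))
    (hM : Φ.range = Algebra.adjoin K ((fun a => (monomial a 1 : MvPolynomial τ K)) '' M))
    (homog : ∀ f, Φ f = 0 → ∀ n, Φ (homogeneousComponent n f) = 0)
    (hΦ : ∃ i, Φ (X i) ≠ 0) :
    ∃ L : σ → MvPolynomial σ K, (∀ i, (L i).IsHomogeneous 1) ∧ LinearIndependent K L ∧
      ∃ B : Set (MvPolynomial σ K),
        (∀ f ∈ B, ∃ a b : σ → ℕ, f = (∏ i, L i ^ a i) - ∏ i, L i ^ b i) ∧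
        RingHom.ker Φ = Ideal.span B := by
  obtain ⟨M', hmin, hM'⟩ := exists_minimalGen (K := K) M
  rw [← hM] at hM'
  have hA : ∀ j : M', ∃ f, Φ f = monomial (j : τ →₀ ℕ) 1 := fun j =>
    hM'.le ⟨X j, monMap_X j⟩
  have hP : ∀ i, ∃ g, monMap K (fun m : M' => (m : τ →₀ ℕ)) g = Φ (X i) := fun i =>
    hM'.ge ⟨X i, rfl⟩
  choose A hA using hA
  choose P hP using hP
  exact IsLift.exists_linear_forms ⟨hmin, hA, hP, homog⟩ hΦ

end MonomialMap

namespace StagedTree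

variable {Θ : Type} [DecidableEq Θ] (T : StagedTree Θ)

lemma depthOf_le_depth (v : T.V) : T.depthOf v ≤ T.depth := Finset.le_sup (Finset.mem_univ v)

lemma hpm_isHomogeneous (v : T.V) : (T.hpm v).IsHomogeneous T.depth := by
  have h1 : ((X none : MvPolynomial (Option Θ) ℝ) ^ (T.depth - T.depthOf v)).IsHomogeneous
      (T.depth - T.depthOf v) := isHomogeneous_X_pow _ _
  have h2 := IsHomogeneous.prod (Finset.range (T.depthOf v))
    (fun i => (X (some (T.label (T.parent^[i] v))) : MvPolynomial (Option Θ) ℝ)) (fun _ => 1)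
    fun i _ => isHomogeneous_X ℝ _
  have h3 := h1.mul h2
  rwa [Finset.sum_const, Finset.card_range, smul_eq_mul, mul_one,
    Nat.sub_add_cancel (T.depthOf_le_depth v)] at h3

lemma homogeneousComponent_mem_sumIdeal {f : MvPolynomial (Option Θ) ℝ} (hf : f ∈ T.sumIdeal)
    (n : ℕ) : homogeneousComponent n f ∈ T.sumIdeal := by
  let : GradedAlgebra (homogeneousSubmodule (Option Θ) ℝ) := MvPolynomial.gradedAlgebra
  refine homogeneousComponent_mem_of_mem (Ideal.homogeneous_span _ _ ?_) hf n
  rintro _ ⟨v, -, rfl⟩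
  exact ⟨1, sub_mem (sum_mem fun c _ => isHomogeneous_X ℝ _) (isHomogeneous_X ℝ _)⟩

lemma phi_eq_mk (f : MvPolynomial T.Leaf ℝ) :
    T.phi f = Ideal.Quotient.mk T.sumIdeal (aeval (fun l : T.Leaf => T.hpm l.1) f) := by
  have : T.phi = (Ideal.Quotient.mkₐ ℝ T.sumIdeal).comp (aeval fun l : T.Leaf => T.hpm l.1) := by
    ext l
    simp [phi]
  rw [this]
  rfl

lemma phi_eq_zero_iff (f : MvPolynomial T.Leaf ℝ) :
    T.phi f = 0 ↔ aeval (fun l : T.Leaf => T.hpm l.1) f ∈ T.sumIdeal := by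
  rw [phi_eq_mk, Ideal.Quotient.eq_zero_iff_mem]

lemma homogeneousComponent_aeval_hpm (hd : T.depth ≠ 0) (f : MvPolynomial T.Leaf ℝ) (n : ℕ) :
    homogeneousComponent (n * T.depth) (aeval (fun l : T.Leaf => T.hpm l.1) f) =
      aeval (fun l : T.Leaf => T.hpm l.1) (homogeneousComponent n f) := by
  have hhom : ∀ {g : MvPolynomial T.Leaf ℝ} {m : ℕ}, g.IsHomogeneous m →
      (aeval (fun l : T.Leaf => T.hpm l.1) g).IsHomogeneous (m * T.depth) := by
    intro g m hg
    rw [mul_comm]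
    exact hg.aeval _ fun l => T.hpm_isHomogeneous l.1
  conv_lhs => rw [← sum_homogeneousComponent f, map_sum, map_sum]
  by_cases hn : n ∈ Finset.range (f.totalDegree + 1)
  · rw [Finset.sum_eq_single_of_mem n hn, homogeneousComponent_of_mem
      (hhom (homogeneousComponent_isHomogeneous n f)), if_pos rfl]
    intro m _ hm
    rw [homogeneousComponent_of_mem (hhom (homogeneousComponent_isHomogeneous m f)), if_neg]
    exact fun e => hm (Nat.eq_of_mul_eq_mul_right (Nat.pos_of_ne_zero hd) e).symm
  · rw [homogeneousComponent_eq_zero _ f (by simpa using hn), map_zero]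
    refine Finset.sum_eq_zero fun m hm => ?_
    rw [homogeneousComponent_of_mem (hhom (homogeneousComponent_isHomogeneous m f)), if_neg]
    rintro e
    rw [Nat.eq_of_mul_eq_mul_right (Nat.pos_of_ne_zero hd) e] at hn
    exact hn hm

lemma phi_homogeneousComponent (hd : T.depth ≠ 0) {f : MvPolynomial T.Leaf ℝ}
    (hf : T.phi f = 0) (n : ℕ) : T.phi (homogeneousComponent n f) = 0 := by
  rw [phi_eq_zero_iff] at hf ⊢
  rw [← T.homogeneousComponent_aeval_hpm hd]
  exact T.homogeneousComponent_mem_sumIdeal hf _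

lemma depthOf_parent_lt {v c : T.V} (h : T.IsChild v c) : T.depthOf v < T.depthOf c := by
  have hc : T.parent^[T.depthOf c] c = T.root := Nat.find_spec (T.reaches_root c)
  cases hd : T.depthOf c with
  | zero =>
    rw [hd] at hc
    exact absurd hc h.1
  | succ n =>
    rw [hd, Function.iterate_succ_apply, h.2] at hc
    exact Nat.lt_succ_of_le (Nat.find_min' (T.reaches_root v) hc)

lemma nonempty_leaf : Nonempty T.Leaf := by
  obtain ⟨v, -, hv⟩ := Finset.exists_max_image Finset.univ T.depthOf ⟨T.root, Finset.mem_univ _⟩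
  exact ⟨⟨v, fun c hc => (T.depthOf_parent_lt hc).not_ge (hv c (Finset.mem_univ c))⟩⟩

/-- The set of outgoing edge labels of a vertex. -/
def floret (v : T.V) : Finset Θ :=
  (Finset.univ.filter fun c => T.IsChild v c).image T.label

lemma mem_floret {v : T.V} {θ : Θ} :
    θ ∈ T.floret v ↔ ∃ c, c ≠ T.root ∧ T.parent c = v ∧ T.label c = θ := by
  simp only [floret, Finset.mem_image, Finset.mem_filter_univ]
  simp only [IsChild, and_assoc]

lemma floret_eq_or_disjoint (u v : T.V) :
    T.floret u = T.floret v ∨ Disjoint (T.floret u) (T.floret v) := by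
  refine (T.stage_disjoint u v).imp (fun h => ?_) fun h => ?_
  · ext θ
    rw [mem_floret, mem_floret, h]
  · rw [Finset.disjoint_left]
    intro θ hu hv
    exact h θ ⟨T.mem_floret.1 hu, T.mem_floret.1 hv⟩

/-- The probability of a label when all florets carry the uniform distribution. -/
def uniformWeight (θ : Θ) : ℝ :=
  if h : ∃ v, θ ∈ T.floret v then ((T.floret h.choose).card : ℝ)⁻¹ else 1

lemma uniformWeight_pos (θ : Θ) : 0 < T.uniformWeight θ := by
  rw [uniformWeight]
  split_ifs with h
  · exact inv_pos.2 (Nat.cast_pos.2 (Finset.card_pos.2 ⟨θ, h.choose_spec⟩))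
  · exact one_pos

lemma uniformWeight_of_mem {v : T.V} {θ : Θ} (h : θ ∈ T.floret v) :
    T.uniformWeight θ = ((T.floret v).card : ℝ)⁻¹ := by
  have hex : ∃ v, θ ∈ T.floret v := ⟨v, h⟩
  rw [uniformWeight, dif_pos hex]
  rcases T.floret_eq_or_disjoint hex.choose v with e | e
  · rw [e]
  · exact absurd h (Finset.disjoint_left.1 e hex.choose_spec)

lemma sum_uniformWeight {v : T.V} (hv : ¬ T.IsLeaf v) :
    ∑ c ∈ Finset.univ.filter (fun c => T.IsChild v c), T.uniformWeight (T.label c) = 1 := by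
  have hinj : Set.InjOn T.label (Finset.univ.filter fun c => T.IsChild v c : Finset T.V) := by
    intro a ha b hb hab
    have ha' := (Finset.mem_filter.1 ha).2
    have hb' := (Finset.mem_filter.1 hb).2
    exact T.label_inj a b ha'.1 hb'.1 (ha'.2.trans hb'.2.symm) hab
  have hsum : ∑ θ ∈ T.floret v, T.uniformWeight θ = 1 := by
    rw [Finset.sum_congr rfl fun θ hθ => T.uniformWeight_of_mem hθ, Finset.sum_const,
      nsmul_eq_mul]
    refine mul_inv_cancel₀ (Nat.cast_ne_zero.2 (Finset.card_ne_zero.2 ?_))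
    obtain ⟨c, hc⟩ := not_forall_not.1 hv
    exact ⟨T.label c, T.mem_floret.2 ⟨c, hc.1, hc.2, rfl⟩⟩
  rwa [floret, Finset.sum_image hinj] at hsum

/-- Evaluation at the uniform distribution on all florets, with `z = 1`. -/
def uniformEval : MvPolynomial (Option Θ) ℝ →ₐ[ℝ] ℝ :=
  aeval fun o => o.elim 1 T.uniformWeight

lemma uniformEval_eq_zero {f : MvPolynomial (Option Θ) ℝ} (hf : f ∈ T.sumIdeal) :
    T.uniformEval f = 0 := by
  have hle : T.sumIdeal ≤ RingHom.ker T.uniformEval := by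
    refine Ideal.span_le.2 ?_
    rintro _ ⟨v, hv, rfl⟩
    simp [uniformEval, T.sum_uniformWeight hv]
  exact hle hf

lemma uniformEval_hpm_pos (v : T.V) : 0 < T.uniformEval (T.hpm v) := by
  simp only [uniformEval, hpm, map_mul, map_pow, map_prod, aeval_X, Option.elim_none,
    Option.elim_some, one_pow, one_mul]
  exact Finset.prod_pos fun i _ => T.uniformWeight_pos _

lemma phi_X_ne_zero (l : T.Leaf) : T.phi (X l) ≠ 0 := by
  rw [Ne, phi_eq_zero_iff, aeval_X]
  exact fun h => (T.uniformEval_hpm_pos l.1).ne' (T.uniformEval_eq_zero h)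

lemma toric_of_depth_eq_zero (hd : T.depth = 0) : T.Toric := by
  have hX : ∀ l, T.phi (X l) = 1 := by
    intro l
    have hl : T.depthOf l.1 = 0 := Nat.le_zero.1 (hd ▸ T.depthOf_le_depth l.1)
    rw [phi_eq_mk, aeval_X, hpm, hd, hl]
    simp
  have hsub : ∀ f, f - C (aeval (fun _ => (1 : ℝ)) f) ∈
      Ideal.span (Set.range fun l : T.Leaf => (X l - 1 : MvPolynomial T.Leaf ℝ)) := by
    intro f
    induction f using MvPolynomial.induction_on with
    | C a => simp
    | add p q hp hq =>
      rw [map_add, map_add, add_sub_add_comm]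
      exact add_mem hp hq
    | mul_X p i hp =>
      rw [map_mul, aeval_X, mul_one, show p * X i - C (aeval (fun _ => (1 : ℝ)) p) =
        p * (X i - 1) + (p - C (aeval (fun _ => (1 : ℝ)) p)) by ring]
      exact add_mem (Ideal.mul_mem_left _ _ (Ideal.subset_span ⟨i, rfl⟩)) hp
  have hle : Ideal.span (Set.range fun l : T.Leaf => (X l - 1 : MvPolynomial T.Leaf ℝ)) ≤
      RingHom.ker T.phi.toRingHom := by
    refine Ideal.span_le.2 ?_
    rintro _ ⟨l, rfl⟩
    change T.phi (X l - 1) = 0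
    rw [map_sub, hX, map_one, sub_self]
  refine ⟨X, fun i => isHomogeneous_X ℝ i, linearIndependent_X _ ℝ, _, ?_,
    le_antisymm (fun f hf => ?_) hle⟩
  · rintro _ ⟨l, rfl⟩
    refine ⟨Pi.single l 1, 0, ?_⟩
    simp [Pi.single_apply, pow_ite]
  have hf0 : T.phi f = 0 := hf
  have h0 : T.phi (f - C (aeval (fun _ => (1 : ℝ)) f)) = 0 := hle (hsub f)
  rw [map_sub, hf0, zero_sub, neg_eq_zero, phi_eq_zero_iff, algHom_C, algebraMap_eq] at h0
  have h1 := T.uniformEval_eq_zero h0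
  rw [algHom_C, Algebra.algebraMap_self, RingHom.id_apply] at h1
  have := hsub f
  rwa [h1, C_0, sub_zero] at this

end StagedTree

namespace StagedTree

variable {Θ : Type} [DecidableEq Θ] (T : StagedTree Θ)

open MvPolynomial

/-- If the algebra `im φ_𝒯` is isomorphic, as an ℝ-algebra, to a monomial
algebra (a subalgebra of a polynomial ring generated by finitely many monomials), then
`ker φ_𝒯` is toric after an appropriate linear change of coordinates. -/
theorem toric_of_monomial_algebra
    (h : ∃ (k : ℕ) (M : Finset (Fin k →₀ ℕ)),
      Nonempty (T.phi.range ≃ₐ[ℝ]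
        (Algebra.adjoin ℝ ((fun a => (monomial a (1 : ℝ) : MvPolynomial (Fin k) ℝ)) '' M)))) :
    T.Toric := by
  obtain ⟨k, M, ⟨e⟩⟩ := h
  rcases eq_or_ne T.depth 0 with hd | hd
  · exact T.toric_of_depth_eq_zero hd
  let Φ : MvPolynomial T.Leaf ℝ →ₐ[ℝ] MvPolynomial (Fin k) ℝ :=
    (Subalgebra.val _).comp (e.toAlgHom.comp T.phi.rangeRestrict)
  have hΦ : ∀ f, Φ f = 0 ↔ T.phi f = 0 := by
    intro f
    change ((e (T.phi.rangeRestrict f) : _) : MvPolynomial (Fin k) ℝ) = 0 ↔ _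
    rw [ZeroMemClass.coe_eq_zero, EmbeddingLike.map_eq_zero_iff, ← ZeroMemClass.coe_eq_zero]
    rfl
  have hrange : Φ.range =
      Algebra.adjoin ℝ ((fun a => (monomial a (1 : ℝ) : MvPolynomial (Fin k) ℝ)) '' M) := by
    ext g
    constructor
    · rintro ⟨f, rfl⟩
      exact (e (T.phi.rangeRestrict f)).2
    · intro hg
      obtain ⟨f, hf⟩ := T.phi.rangeRestrict_surjective (e.symm ⟨g, hg⟩)
      refine ⟨f, ?_⟩
      change ((e (T.phi.rangeRestrict f) : _) : MvPolynomial (Fin k) ℝ) = g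
      rw [hf, AlgEquiv.apply_symm_apply]
  obtain ⟨l⟩ := T.nonempty_leaf
  obtain ⟨L, hL, hli, B, hB, hker⟩ := MonomialMap.exists_linear_forms_of_range_eq Φ M hrange
    (fun f hf n => (hΦ _).2 (T.phi_homogeneousComponent hd ((hΦ f).1 hf) n))
    ⟨l, fun h0 => T.phi_X_ne_zero l ((hΦ _).1 h0)⟩
  refine ⟨L, hL, hli, B, hB, ?_⟩
  rw [← hker]
  ext f
  exact (hΦ f).symm

end StagedTree
end
end

section
/- Let u and v be vertices of the same stage in a balanced staged tree, and suppose mult_c(u_i) > mult_c(u_j) for some colour c and some indices i, j of children. Then mult_c(v_i) > mult_c(v_j). -/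
noncomputable section
open scoped Classical
open MvPolynomial

namespace StagedTree

variable {Θ : Type} [DecidableEq Θ] (T : StagedTree Θ)

/-- The set of labels of the outgoing edges of `v`, as a finset (the colour of `v`). -/
def labelFinset (v : T.V) : Finset Θ :=
  (Finset.univ.filter (fun c => T.IsChild v c)).image T.label

/-- The number of vertices of colour `c` on the path from `w` down to the leaf `l`. -/
def pathCount (c : Finset Θ) (w l : T.V) : ℕ :=
  (Finset.univ.filter (fun x => T.Desc w x ∧ T.Desc x l ∧ T.labelFinset x = c)).card

/-- The multiplicity `mult_c(w)`: the greatest `m` such that every `w`-to-leaf path passes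
through at least `m` vertices of colour `c`, i.e. the minimum of the path counts. -/
def mult (c : Finset Θ) (w : T.V) : ℕ :=
  sInf {k : ℕ | ∃ l, T.IsLeaf l ∧ T.Desc w l ∧ k = T.pathCount c w l}

lemma depthOf_root : T.depthOf T.root = 0 := by
  simp [depthOf]

lemma depthOf_eq_zero_iff {x : T.V} : T.depthOf x = 0 ↔ x = T.root := by
  simp [depthOf]

lemma iterate_parent_depthOf (x : T.V) : T.parent^[T.depthOf x] x = T.root :=
  Nat.find_spec (T.reaches_root x)

lemma depthOf_eq_succ {x : T.V} (hx : x ≠ T.root) :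
    T.depthOf x = T.depthOf (T.parent x) + 1 := by
  apply le_antisymm
  · refine Nat.find_min' _ ?_
    rw [Function.iterate_succ_apply]
    exact T.iterate_parent_depthOf _
  · obtain ⟨k, hk⟩ := Nat.exists_eq_succ_of_ne_zero (fun h => hx (T.depthOf_eq_zero_iff.1 h))
    have h := T.iterate_parent_depthOf x
    rw [hk, Nat.succ_eq_add_one, Function.iterate_succ_apply] at h
    have : T.depthOf (T.parent x) ≤ k := Nat.find_min' _ h
    omega

lemma depthOf_parent (x : T.V) : T.depthOf (T.parent x) = T.depthOf x - 1 := by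
  by_cases hx : x = T.root
  · subst hx
    rw [T.parent_root, T.depthOf_root]
  · rw [T.depthOf_eq_succ hx, Nat.add_sub_cancel]

lemma depthOf_iterate_parent (x : T.V) (n : ℕ) :
    T.depthOf (T.parent^[n] x) = T.depthOf x - n := by
  induction n with
  | zero => simp
  | succ n ih => rw [Function.iterate_succ_apply', T.depthOf_parent, ih, Nat.sub_sub]

lemma Desc.depthOf_le {w x : T.V} (h : T.Desc w x) : T.depthOf w ≤ T.depthOf x := by
  obtain ⟨n, rfl⟩ := h
  rw [T.depthOf_iterate_parent]
  exact Nat.sub_le _ _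

lemma Desc.iterate_parent_eq {w x : T.V} (h : T.Desc w x) :
    T.parent^[T.depthOf x - T.depthOf w] x = w := by
  obtain ⟨n, rfl⟩ := h
  rw [T.depthOf_iterate_parent]
  rcases le_total n (T.depthOf x) with h | h
  · rw [Nat.sub_sub_self h]
  · have hr : T.parent^[n] x = T.root := by
      rw [← T.depthOf_eq_zero_iff, T.depthOf_iterate_parent]
      omega
    rw [hr, Nat.sub_eq_zero_of_le h, Nat.sub_zero, T.iterate_parent_depthOf]

lemma exists_leaf_desc (w : T.V) : ∃ l, T.IsLeaf l ∧ T.Desc w l := by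
  obtain ⟨l, hl, hmax⟩ := (Finset.univ.filter (T.Desc w)).exists_max_image T.depthOf
    ⟨w, by simpa using ⟨0, rfl⟩⟩
  simp only [Finset.mem_filter, Finset.mem_univ, true_and] at hl hmax
  refine ⟨l, fun x hx => ?_, hl⟩
  obtain ⟨n, hn⟩ := hl
  have h := hmax x ⟨n + 1, by rw [Function.iterate_succ_apply, hx.2, hn]⟩
  rw [T.depthOf_eq_succ hx.1, hx.2] at h
  omega

lemma mem_labelFinset {x : T.V} {θ : Θ} :
    θ ∈ T.labelFinset x ↔ ∃ y, T.IsChild x y ∧ T.label y = θ := by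
  simp [labelFinset]

/-- A label occurring in the colours of two vertices forces these colours to agree. -/
lemma labelFinset_eq_of_mem {x y : T.V} {θ : Θ} (hx : θ ∈ T.labelFinset x)
    (hy : θ ∈ T.labelFinset y) : T.labelFinset x = T.labelFinset y := by
  rw [mem_labelFinset] at hx hy
  rcases T.stage_disjoint x y with h | h
  · ext η
    simpa only [mem_labelFinset, IsChild, and_assoc] using h η
  · exact absurd ⟨by simpa only [IsChild, and_assoc] using hx,
      by simpa only [IsChild, and_assoc] using hy⟩ (h θ)

lemma label_mem_iff {x y : T.V} (hx : x ≠ T.root) :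
    T.label x ∈ T.labelFinset y ↔ T.labelFinset (T.parent x) = T.labelFinset y := by
  have h : T.label x ∈ T.labelFinset (T.parent x) := T.mem_labelFinset.2 ⟨x, ⟨hx, rfl⟩, rfl⟩
  exact ⟨T.labelFinset_eq_of_mem h, fun e => e ▸ h⟩

lemma labelFinset_eq_empty_iff {x : T.V} : T.labelFinset x = ∅ ↔ T.IsLeaf x := by
  simp [labelFinset, IsLeaf, Finset.filter_eq_empty_iff]

/-- The vertices of colour `c` on a `w`-to-leaf path correspond to the edges of the path
whose label lies in `c`. -/
lemma pathCount_eq_card_label_mem {x w l : T.V} (hx : ¬ T.IsLeaf x) (hl : T.IsLeaf l)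
    (hwl : T.Desc w l) :
    T.pathCount (T.labelFinset x) w l = ((Finset.range (T.depthOf l - T.depthOf w)).filter
      (fun i => T.label (T.parent^[i] l) ∈ T.labelFinset x)).card := by
  have hne : ∀ i < T.depthOf l - T.depthOf w, T.parent^[i] l ≠ T.root := by
    intro i hi h
    rw [← T.depthOf_eq_zero_iff, T.depthOf_iterate_parent] at h
    omega
  symm
  refine Finset.card_bij (fun i _ => T.parent^[i + 1] l) ?_ ?_ ?_
  · intro i hi
    simp only [Finset.mem_filter, Finset.mem_range, Finset.mem_univ, true_and] at hi ⊢
    refine ⟨⟨T.depthOf l - T.depthOf w - (i + 1), ?_⟩, ⟨i + 1, rfl⟩, ?_⟩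
    · rw [← Function.iterate_add_apply, Nat.sub_add_cancel (by omega)]
      exact hwl.iterate_parent_eq
    · rw [Function.iterate_succ_apply']
      exact (T.label_mem_iff (hne i hi.1)).1 hi.2
  · intro i hi j hj h
    simp only [Finset.mem_filter, Finset.mem_range] at hi hj
    have h' := congrArg T.depthOf h
    simp only [T.depthOf_iterate_parent] at h'
    omega
  · intro y hy
    simp only [Finset.mem_filter, Finset.mem_univ, true_and] at hy
    obtain ⟨hwy, hyl, hc⟩ := hy
    have hpos : T.depthOf l - T.depthOf y ≠ 0 := by
      intro h
      have h' := hyl.iterate_parent_eq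
      rw [h, Function.iterate_zero_apply] at h'
      rw [← h', T.labelFinset_eq_empty_iff.2 hl] at hc
      exact hx (T.labelFinset_eq_empty_iff.1 hc.symm)
    have h1 := hwy.depthOf_le
    have heq : T.parent^[T.depthOf l - T.depthOf y - 1 + 1] l = y := by
      rw [Nat.sub_add_cancel (Nat.one_le_iff_ne_zero.2 hpos)]
      exact hyl.iterate_parent_eq
    have hlt : T.depthOf l - T.depthOf y - 1 < T.depthOf l - T.depthOf w := by omega
    refine ⟨T.depthOf l - T.depthOf y - 1, ?_, heq⟩
    simp only [Finset.mem_filter, Finset.mem_range]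
    refine ⟨hlt, (T.label_mem_iff (hne _ hlt)).2 ?_⟩
    rw [← Function.iterate_succ_apply' T.parent, heq, hc]

/-- Specialise the labels in `c` to the variable `X` and all the others to `1`. -/
def colourEval (c : Finset Θ) : MvPolynomial Θ ℝ →ₐ[ℝ] Polynomial ℝ :=
  aeval (fun θ => if θ ∈ c then Polynomial.X else 1)

lemma colourEval_tpoly {x : T.V} (hx : ¬ T.IsLeaf x) (w : T.V) :
    colourEval (T.labelFinset x) (T.tpoly w) =
      ∑ l ∈ Finset.univ.filter (fun l => T.IsLeaf l ∧ T.Desc w l),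
        Polynomial.X ^ T.pathCount (T.labelFinset x) w l := by
  rw [tpoly, map_sum]
  refine Finset.sum_congr rfl fun l hl => ?_
  simp only [Finset.mem_filter, Finset.mem_univ, true_and] at hl
  rw [T.pathCount_eq_card_label_mem hx hl.1 hl.2, map_prod, ← Finset.prod_const,
    Finset.prod_filter]
  simp [colourEval]

lemma coeff_colourEval_tpoly {x : T.V} (hx : ¬ T.IsLeaf x) (w : T.V) (n : ℕ) :
    (colourEval (T.labelFinset x) (T.tpoly w)).coeff n =
      ((Finset.univ.filter (fun l => T.IsLeaf l ∧ T.Desc w l)).filter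
        (fun l => n = T.pathCount (T.labelFinset x) w l)).card := by
  simp only [T.colourEval_tpoly hx, Polynomial.finsetSum_coeff, Polynomial.coeff_X_pow,
    Finset.sum_boole]

lemma coeff_colourEval_tpoly_ne_zero_iff {x : T.V} (hx : ¬ T.IsLeaf x) (w : T.V) (n : ℕ) :
    (colourEval (T.labelFinset x) (T.tpoly w)).coeff n ≠ 0 ↔
      ∃ l, T.IsLeaf l ∧ T.Desc w l ∧ n = T.pathCount (T.labelFinset x) w l := by
  rw [T.coeff_colourEval_tpoly hx, Nat.cast_ne_zero, Finset.card_ne_zero]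
  simp [Finset.Nonempty, and_assoc]

lemma coeff_colourEval_tpoly_mult {x : T.V} (hx : ¬ T.IsLeaf x) (w : T.V) :
    (colourEval (T.labelFinset x) (T.tpoly w)).coeff (T.mult (T.labelFinset x) w) ≠ 0 := by
  rw [T.coeff_colourEval_tpoly_ne_zero_iff hx]
  obtain ⟨l, hl, hwl⟩ := T.exists_leaf_desc w
  exact Nat.sInf_mem (s := {k | ∃ l, T.IsLeaf l ∧ T.Desc w l ∧
    k = T.pathCount (T.labelFinset x) w l}) ⟨_, l, hl, hwl, rfl⟩

lemma colourEval_tpoly_ne_zero {x : T.V} (hx : ¬ T.IsLeaf x) (w : T.V) :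
    colourEval (T.labelFinset x) (T.tpoly w) ≠ 0 := fun h =>
  T.coeff_colourEval_tpoly_mult hx w (by rw [h, Polynomial.coeff_zero])

lemma natTrailingDegree_colourEval_tpoly {x : T.V} (hx : ¬ T.IsLeaf x) (w : T.V) :
    (colourEval (T.labelFinset x) (T.tpoly w)).natTrailingDegree =
      T.mult (T.labelFinset x) w := by
  apply le_antisymm
  · exact Polynomial.natTrailingDegree_le_of_ne_zero (T.coeff_colourEval_tpoly_mult hx w)
  · refine Polynomial.le_natTrailingDegree (T.colourEval_tpoly_ne_zero hx w) fun n hn => ?_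
    by_contra h
    exact Nat.notMem_of_lt_sInf hn ((T.coeff_colourEval_tpoly_ne_zero_iff hx w n).1 h)

/-- Let `u ∼ v` be vertices of the same stage in a balanced staged tree
and let `c` be a colour with `mult_c(u_i) > mult_c(u_j)` for children matched via the
common labels. Then `mult_c(v_i) > mult_c(v_j)`. -/
theorem mult_lt_of_mult_lt (hbal : T.Balanced) (c : Finset Θ)
    (hc : ∃ x, ¬ T.IsLeaf x ∧ T.labelFinset x = c)
    (u v ui uj vi vj : T.V) (huv : T.SameStage u v)
    (hui : T.IsChild u ui) (huj : T.IsChild u uj)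
    (hvi : T.IsChild v vi) (hvj : T.IsChild v vj)
    (hlabi : T.label ui = T.label vi) (hlabj : T.label uj = T.label vj)
    (hmu : T.mult c uj < T.mult c ui) :
    T.mult c vj < T.mult c vi := by
  obtain ⟨x, hx, rfl⟩ := hc
  have h := congrArg (fun p => (colourEval (T.labelFinset x) p).natTrailingDegree)
    (hbal u v ui uj vi vj huv hui huj hvi hvj hlabi hlabj)
  simp only [map_mul] at h
  rw [Polynomial.natTrailingDegree_mul (T.colourEval_tpoly_ne_zero hx _)
      (T.colourEval_tpoly_ne_zero hx _),
    Polynomial.natTrailingDegree_mul (T.colourEval_tpoly_ne_zero hx _)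
      (T.colourEval_tpoly_ne_zero hx _)] at h
  simp only [T.natTrailingDegree_colourEval_tpoly hx] at h
  omega

end StagedTree
end
end

section
/- In a balanced staged tree, suppose a vertex v is in the same stage as all of its children. Then the subtree polynomials of its grandchildren satisfy t(v_{ij}) = t(v_{ji}) for all i, j, where v_{ij} denotes the j-th child of the i-th child v_i of v (children being indexed by the common stage labels). -/
noncomputable section
open scoped Classical
open MvPolynomial

namespace StagedTree

variable {Θ : Type} [DecidableEq Θ] (T : StagedTree Θ)

theorem depthOf_eq_succ_s12 {v c : T.V} (h : T.IsChild v c) :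
    T.depthOf c = T.depthOf v + 1 := by
  obtain ⟨hc, rfl⟩ := h
  unfold depthOf
  rw [Nat.find_eq_iff]
  refine ⟨?_, fun n hn => ?_⟩
  · rw [Function.iterate_succ_apply]
    exact Nat.find_spec (T.reaches_root (T.parent c))
  · cases n with
    | zero => exact hc
    | succ n =>
      rw [Function.iterate_succ_apply]
      exact Nat.find_min (T.reaches_root (T.parent c)) (by omega)

/-- An ancestor of `w` is reached from `w` in as many steps as the depths differ. -/
theorem Desc.depthOf_le_and_iterate {v w : T.V} (h : T.Desc v w) :
    T.depthOf v ≤ T.depthOf w ∧ T.parent^[T.depthOf w - T.depthOf v] w = v := by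
  obtain ⟨n, hn⟩ := h
  induction n generalizing w with
  | zero =>
    obtain rfl : w = v := hn
    simp
  | succ n ih =>
    rw [Function.iterate_succ_apply] at hn
    obtain ⟨h₁, h₂⟩ := ih hn
    by_cases hw : w = T.root
    · subst hw
      rw [T.parent_root] at h₁ h₂
      exact ⟨h₁, h₂⟩
    · have hd := T.depthOf_eq_succ_s12 (v := T.parent w) ⟨hw, rfl⟩
      refine ⟨by omega, ?_⟩
      rw [hd, Nat.succ_sub h₁, Function.iterate_succ_apply, h₂]

theorem Desc.trans_isChild {v c w : T.V} (h : T.IsChild v c) (hw : T.Desc c w) : T.Desc v w := by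
  obtain ⟨n, rfl⟩ := hw
  exact ⟨n + 1, by rw [Function.iterate_succ_apply']; exact h.2⟩

theorem Desc.exists_isChild {v w : T.V} (h : T.Desc v w) (hne : w ≠ v) :
    ∃ c, T.IsChild v c ∧ T.Desc c w := by
  obtain ⟨n, hn⟩ := h
  induction n generalizing w with
  | zero => exact absurd hn hne
  | succ n ih =>
    rw [Function.iterate_succ_apply] at hn
    by_cases hp : T.parent w = v
    · refine ⟨w, ⟨?_, hp⟩, 0, rfl⟩
      rintro rfl
      exact hne (T.parent_root.symm.trans hp)
    · obtain ⟨c, hc, m, hm⟩ := ih hp hn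
      exact ⟨c, hc, m + 1, by rw [Function.iterate_succ_apply]; exact hm⟩

theorem exists_isLeaf_desc (v : T.V) : ∃ w, T.IsLeaf w ∧ T.Desc v w := by
  obtain ⟨w, hw, hmax⟩ := (Finset.univ.filter (T.Desc v)).exists_max_image T.depthOf
    ⟨v, by simpa using ⟨0, rfl⟩⟩
  simp only [Finset.mem_filter, Finset.mem_univ, true_and] at hw hmax
  refine ⟨w, fun c hc => ?_, hw⟩
  obtain ⟨n, hn⟩ := hw
  have := hmax c ⟨n + 1, by rw [Function.iterate_succ_apply, hc.2, hn]⟩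
  have := T.depthOf_eq_succ_s12 hc
  omega

theorem tpoly_ne_zero (v : T.V) : T.tpoly v ≠ 0 := by
  intro h
  have h₁ := congrArg (eval fun _ => (1 : ℝ)) h
  simp only [tpoly, map_sum, map_prod, eval_X, Finset.prod_const_one, Finset.sum_const,
    nsmul_eq_mul, mul_one, map_zero, Nat.cast_eq_zero, Finset.card_eq_zero] at h₁
  obtain ⟨w, hw⟩ := T.exists_isLeaf_desc v
  exact Finset.eq_empty_iff_forall_notMem.mp h₁ w (by simpa using hw)

theorem tpoly_eq_sum_isChild {v : T.V} (hv : ¬ T.IsLeaf v) :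
    T.tpoly v = ∑ c ∈ Finset.univ.filter (T.IsChild v), X (T.label c) * T.tpoly c := by
  have hU : Finset.univ.filter (fun w => T.IsLeaf w ∧ T.Desc v w) =
      (Finset.univ.filter (T.IsChild v)).biUnion
        fun c => Finset.univ.filter (fun w => T.IsLeaf w ∧ T.Desc c w) := by
    ext w
    simp only [Finset.mem_filter, Finset.mem_univ, true_and, Finset.mem_biUnion]
    constructor
    · rintro ⟨hl, hd⟩
      obtain ⟨c, hc, hcw⟩ := hd.exists_isChild T (by rintro rfl; exact hv hl)
      exact ⟨c, hc, hl, hcw⟩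
    · rintro ⟨c, hc, hl, hcw⟩
      exact ⟨hl, hcw.trans_isChild T hc⟩
  unfold tpoly
  rw [hU, Finset.sum_biUnion]
  · refine Finset.sum_congr rfl fun c hc => ?_
    rw [Finset.mul_sum]
    refine Finset.sum_congr rfl fun w hw => ?_
    simp only [Finset.mem_filter, Finset.mem_univ, true_and] at hc hw
    obtain ⟨hle, hit⟩ := hw.2.depthOf_le_and_iterate T
    have hd := T.depthOf_eq_succ_s12 hc
    rw [show T.depthOf w - T.depthOf v = (T.depthOf w - T.depthOf c) + 1 by omega,
      Finset.prod_range_succ, hit, mul_comm]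
  · intro c hc c' hc' hne
    simp only [Finset.coe_filter, Finset.mem_univ, true_and, Set.mem_ofPred_eq] at hc hc'
    refine Finset.disjoint_left.mpr fun w hw hw' => hne ?_
    simp only [Finset.mem_filter, Finset.mem_univ, true_and] at hw hw'
    have h₁ := (hw.2.depthOf_le_and_iterate T).2
    have h₂ := (hw'.2.depthOf_le_and_iterate T).2
    rw [T.depthOf_eq_succ_s12 hc] at h₁
    rw [T.depthOf_eq_succ_s12 hc'] at h₂
    exact h₁.symm.trans h₂

/-- In a balanced staged tree, let `u` be in the same stage as `v`. If the child `w` of `u`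
matches the child `c` of `v`, then `t(v) * t(w) = t(c) * t(u)`. -/
theorem Balanced.tpoly_mul_tpoly (hbal : T.Balanced) {v u c w : T.V} (h : T.SameStage v u)
    (hc : T.IsChild v c) (hw : T.IsChild u w) (hl : T.label w = T.label c) :
    T.tpoly v * T.tpoly w = T.tpoly c * T.tpoly u := by
  have hex : ∀ m : T.V, ∃ x, T.IsChild v m → T.IsChild u x ∧ T.label x = T.label m := by
    intro m
    by_cases hm : T.IsChild v m
    · obtain ⟨x, hx⟩ := (h.2.2 _).1 ⟨m, hm, rfl⟩
      exact ⟨x, fun _ => hx⟩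
    · exact ⟨m, fun hm' => absurd hm' hm⟩
  choose f hf using hex
  have hu : T.tpoly u =
      ∑ m ∈ Finset.univ.filter (T.IsChild v), X (T.label m) * T.tpoly (f m) := by
    rw [T.tpoly_eq_sum_isChild h.2.1]
    symm
    refine Finset.sum_bij (fun m _ => f m) ?_ ?_ ?_ ?_
    · intro m hm
      simpa using (hf m (by simpa using hm)).1
    · intro m hm m' hm' he
      simp only [Finset.mem_filter, Finset.mem_univ, true_and] at hm hm'
      exact T.label_inj m m' hm.1 hm'.1 (hm.2.trans hm'.2.symm)
        ((hf m hm).2.symm.trans ((congrArg T.label he).trans (hf m' hm').2))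
    · intro x hx
      simp only [Finset.mem_filter, Finset.mem_univ, true_and] at hx
      obtain ⟨m, hm, hmx⟩ := (h.2.2 _).2 ⟨x, hx, rfl⟩
      obtain ⟨h₁, h₂⟩ := hf m hm
      exact ⟨m, by simpa using hm,
        T.label_inj _ _ h₁.1 hx.1 (h₁.2.trans hx.2.symm) (h₂.trans hmx)⟩
    · intro m hm
      rw [(hf m (by simpa using hm)).2]
  rw [hu, T.tpoly_eq_sum_isChild h.1, Finset.sum_mul, Finset.mul_sum]
  refine Finset.sum_congr rfl fun m hm => ?_
  simp only [Finset.mem_filter, Finset.mem_univ, true_and] at hm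
  obtain ⟨h₁, h₂⟩ := hf m hm
  rw [mul_assoc, hbal v u m c (f m) w h hm hc h₁ hw h₂.symm hl.symm]
  ring

/-- In a balanced staged tree, if a vertex `v` is in the same stage as
all of its children, then the subtree polynomials of its grandchildren satisfy
`t(v_{ij}) = t(v_{ji})`, where children are indexed by the common stage labels. -/
theorem tpoly_grandchildren_symm (hbal : T.Balanced) (v : T.V)
    (hv : ∀ c, T.IsChild v c → T.SameStage v c) :
    ∀ vi vj wij wji : T.V, T.IsChild v vi → T.IsChild v vj →
      T.IsChild vi wij → T.IsChild vj wji →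
      T.label wij = T.label vj → T.label wji = T.label vi →
      T.tpoly wij = T.tpoly wji := by
  intro vi vj wij wji hi hj hij hji hlij hlji
  refine mul_left_cancel₀ (T.tpoly_ne_zero v) ?_
  rw [hbal.tpoly_mul_tpoly T (hv vi hi) hj hij hlij,
    hbal.tpoly_mul_tpoly T (hv vj hj) hi hji hlji, mul_comm]

end StagedTree
end
end
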